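/- arXiv:1111.6146 — 3 statements merged into one kernel-verified Lean document; each statement's English description precedes it below -/
import Mathlib

section
/- Let w ∈ S_n be almost defined by inclusions, let v ∈ S_n be a permutation with E(v) = E(w) ∖ E″(w) and r_v(p,q) = r_w(p,q) for all (p,q) ∈ E(v), let (p,q) ∈ E″(w), and set r = r_w(p,q). Then I_{(p,q,r)} is contained in the ideal I_v + ⟨d_{{p,…,p+r},{q−r,…,q}}⟩ of S. -/
/-- One-line notation value of a permutation of `Fin n` at a position `k ∈ {1,…,n}`;
junk value `0` outside that range. -/
def pval {n : ℕ} (w : Equiv.Perm (Fin n)) (k : ℕ) : ℕ :=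
  if h : 1 ≤ k ∧ k ≤ n then ((w ⟨k - 1, by omega⟩ : Fin n) : ℕ) + 1 else 0

/-- The rank function `r_w(p,q) = #{k ≤ q : w(k) ≥ p}`. -/
def rk {n : ℕ} (w : Equiv.Perm (Fin n)) (p q : ℕ) : ℕ :=
  ((Finset.Icc 1 n).filter fun k => k ≤ q ∧ p ≤ pval w k).card

/-- The Rothe diagram `D(w) = {(p,q) ∈ {1,…,n}² : w(q) < p and w⁻¹(p) > q}`. -/
def Diagram {n : ℕ} (w : Equiv.Perm (Fin n)) : Set (ℕ × ℕ) :=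
  {pq | 1 ≤ pq.1 ∧ pq.1 ≤ n ∧ 1 ≤ pq.2 ∧ pq.2 ≤ n ∧
    pval w pq.2 < pq.1 ∧ pq.2 < pval w.symm pq.1}

/-- The essential set `E(w)`. -/
def EssSet {n : ℕ} (w : Equiv.Perm (Fin n)) : Set (ℕ × ℕ) :=
  {pq | pq ∈ Diagram w ∧ (pq.1, pq.2 + 1) ∉ Diagram w ∧ (pq.1 - 1, pq.2) ∉ Diagram w}

/-- Condition A at `(p,q)`: there is no `k` with `k ≤ q` and `w(k) ≥ p`. -/
def CondA {n : ℕ} (w : Equiv.Perm (Fin n)) (p q : ℕ) : Prop :=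
  ¬ ∃ k, 1 ≤ k ∧ k ≤ n ∧ k ≤ q ∧ p ≤ pval w k

/-- Condition B at `(p,q)`: there is no `k` with `k > q` and `w(k) < p`. -/
def CondB {n : ℕ} (w : Equiv.Perm (Fin n)) (p q : ℕ) : Prop :=
  ¬ ∃ k, 1 ≤ k ∧ k ≤ n ∧ q < k ∧ pval w k < p

/-- `w` is defined by inclusions if every essential set box satisfies Condition A or B. -/
def DefinedByInclusions {n : ℕ} (w : Equiv.Perm (Fin n)) : Prop :=
  ∀ p q, (p, q) ∈ EssSet w → CondA w p q ∨ CondB w p q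

/-- Condition W at `(p,q) ∈ E(w)`. -/
def CondW {n : ℕ} (w : Equiv.Perm (Fin n)) (p q : ℕ) : Prop :=
  (∀ p' < p, (p', q) ∉ EssSet w) ∧
    ((p, q - 1) ∉ Diagram w ∨
      ∃ p' < p, (p', q - 1) ∈ EssSet w ∧ CondB w p' (q - 1) ∧
        rk w p' (q - 1) = rk w p q)

/-- Condition X at `(p,q) ∈ E(w)`. -/
def CondX {n : ℕ} (w : Equiv.Perm (Fin n)) (p q : ℕ) : Prop :=
  ∃ p' < p, (p', q) ∈ EssSet w ∧ (∀ p'' < p, (p'', q) ∈ EssSet w → p'' = p') ∧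
    CondB w p' q ∧ rk w p' q = rk w p q + 1 ∧
    ∃ q', IsLeast {c | ∀ b, c ≤ b → b ≤ q → (p', b) ∈ Diagram w} q' ∧
      (p, q' - 1) ∈ Diagram w

/-- Condition Y at `(p,q) ∈ E(w)`. -/
def CondY {n : ℕ} (w : Equiv.Perm (Fin n)) (p q : ℕ) : Prop :=
  (∀ q' > q, (p, q') ∉ EssSet w) ∧
    ((p + 1, q) ∉ Diagram w ∨
      ∃ q' > q, (p + 1, q') ∈ EssSet w ∧ CondB w (p + 1) q' ∧
        rk w (p + 1) q' = rk w p q)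

/-- Condition Z at `(p,q) ∈ E(w)`. -/
def CondZ {n : ℕ} (w : Equiv.Perm (Fin n)) (p q : ℕ) : Prop :=
  ∃ q' > q, (p, q') ∈ EssSet w ∧ (∀ q'' > q, (p, q'') ∈ EssSet w → q'' = q') ∧
    CondB w p q' ∧ rk w p q' = rk w p q + 1 ∧
    ∃ p', IsGreatest {c | ∀ a, p ≤ a → a ≤ c → (a, q') ∈ Diagram w} p' ∧
      (p' + 1, q) ∈ Diagram w

/-- `w` is almost defined by inclusions if every essential box satisfies Condition A or B,
or satisfies both one of Conditions W and X and one of Conditions Y and Z. -/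
def AlmostDBI {n : ℕ} (w : Equiv.Perm (Fin n)) : Prop :=
  ∀ p q, (p, q) ∈ EssSet w →
    (CondA w p q ∨ CondB w p q) ∨
      ((CondW w p q ∨ CondX w p q) ∧ (CondY w p q ∨ CondZ w p q))
/-- `E″(w)`: the essential boxes satisfying neither Condition A nor Condition B. -/
def EssSet'' {n : ℕ} (w : Equiv.Perm (Fin n)) : Set (ℕ × ℕ) :=
  {pq | pq ∈ EssSet w ∧ ¬ CondA w pq.1 pq.2 ∧ ¬ CondB w pq.1 pq.2}

/-- Index type for the variables `z_{i,j}` with `1 ≤ j < i ≤ n`. -/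
abbrev Idx (n : ℕ) : Type := {p : ℕ × ℕ // 1 ≤ p.2 ∧ p.2 < p.1 ∧ p.1 ≤ n}

/-- The polynomial ring `S = ℚ[z_{i,j} : 1 ≤ j < i ≤ n]`. -/
abbrev PolyS (n : ℕ) : Type := MvPolynomial (Idx n) ℚ

/-- The variable `z_{i,j}` of `S` (junk value `0` when `(i,j)` is out of range). -/
noncomputable def zvar (n : ℕ) (i j : ℕ) : PolyS n :=
  if h : 1 ≤ j ∧ j < i ∧ i ≤ n then MvPolynomial.X ⟨(i, j), h⟩ else 0

/-- The `(i,j)` entry of the matrix `M`: `1` on the diagonal, `z_{i,j}` below the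
diagonal, `0` above it (rows and columns indexed by `{1,…,n}`). -/
noncomputable def Mmat (n : ℕ) (i j : ℕ) : PolyS n :=
  if i = j ∧ 1 ≤ i ∧ i ≤ n then 1 else zvar n i j

/-- The generalized Plücker coordinate `d_{A,B}`: the minor of `M` with rows `A` and
columns `B`, both listed in increasing order (junk value `0` when `#A ≠ #B`). -/
noncomputable def dminor (n : ℕ) (A B : Finset ℕ) : PolyS n :=
  if h : B.card = A.card then
    Matrix.det (Matrix.of fun i j : Fin A.card =>
      Mmat n ((A.orderIsoOfFin rfl i : ℕ)) ((B.orderIsoOfFin h j : ℕ)))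
  else 0

/-- The ideal `I_{(p,q,r)}` generated by all `d_{A,B}` with `A ⊆ {p,…,n}`,
`B ⊆ {1,…,q}` and `#A = #B = r+1`. -/
noncomputable def Iideal (n p q r : ℕ) : Ideal (PolyS n) :=
  Ideal.span {f | ∃ A B : Finset ℕ, A.card = r + 1 ∧ B.card = r + 1 ∧
    A ⊆ Finset.Icc p n ∧ B ⊆ Finset.Icc 1 q ∧ f = dminor n A B}

/-- The ideal `I_w = Σ_{(p,q) ∈ E(w)} I_{(p,q,r_w(p,q))}`. -/
noncomputable def Iw {n : ℕ} (w : Equiv.Perm (Fin n)) : Ideal (PolyS n) :=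
  ⨆ pq ∈ EssSet w, Iideal n pq.1 pq.2 (rk w pq.1 pq.2)

section Combinatorics

variable {n : ℕ} (w : Equiv.Perm (Fin n))

theorem pval_mem_Icc {k : ℕ} (h : 1 ≤ k) (h' : k ≤ n) : 1 ≤ pval w k ∧ pval w k ≤ n := by
  have := (w ⟨k - 1, by omega⟩).2
  simp only [pval, h, h', and_self, dite_true]
  omega

theorem pval_symm_pval {k : ℕ} (h : 1 ≤ k) (h' : k ≤ n) : pval w.symm (pval w k) = k := by
  obtain ⟨h1, h2⟩ := pval_mem_Icc w h h'
  have h3 : pval w k = (w ⟨k - 1, by omega⟩ : ℕ) + 1 := by simp [pval, h, h']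
  rw [pval, dif_pos ⟨h1, h2⟩]
  simp only [h3, Nat.add_sub_cancel, Fin.eta, Equiv.symm_apply_apply]
  omega

theorem pval_pval_symm {k : ℕ} (h : 1 ≤ k) (h' : k ≤ n) : pval w (pval w.symm k) = k :=
  pval_symm_pval w.symm h h'

theorem mem_Diagram {p q : ℕ} : (p, q) ∈ Diagram w ↔ 1 ≤ p ∧ p ≤ n ∧ 1 ≤ q ∧ q ≤ n ∧
    pval w q < p ∧ q < pval w.symm p := Iff.rfl

theorem rk_succ_right {p q : ℕ} (h : q + 1 ≤ n) :
    rk w p (q + 1) = rk w p q + if p ≤ pval w (q + 1) then 1 else 0 := by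
  unfold rk
  split_ifs with hp
  · rw [← Finset.card_insert_of_notMem (a := q + 1) (by simp)]
    congr 1
    ext k
    simp only [Finset.mem_filter, Finset.mem_Icc, Finset.mem_insert]
    constructor
    · rintro ⟨h1, h2, h3⟩
      by_cases hk : k = q + 1
      · exact Or.inl hk
      · exact Or.inr ⟨h1, by omega, h3⟩
    · rintro (rfl | ⟨h1, h2, h3⟩)
      · exact ⟨by omega, le_rfl, hp⟩
      · exact ⟨h1, by omega, h3⟩
  · refine (congrArg Finset.card ?_).trans (Nat.add_zero _).symm
    ext k
    simp only [Finset.mem_filter, Finset.mem_Icc]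
    constructor
    · rintro ⟨h1, h2, h3⟩
      refine ⟨h1, ?_, h3⟩
      by_contra hk
      obtain rfl : k = q + 1 := by omega
      exact hp h3
    · rintro ⟨h1, h2, h3⟩
      exact ⟨h1, by omega, h3⟩

theorem rk_eq_rk_succ_left {p q : ℕ} (h : 1 ≤ p) (h' : p ≤ n) :
    rk w p q = rk w (p + 1) q + if pval w.symm p ≤ q then 1 else 0 := by
  obtain ⟨g1, g2⟩ := pval_mem_Icc w.symm h h'
  have g3 := pval_pval_symm w h h'
  have key : ∀ k, 1 ≤ k → k ≤ n → pval w k = p → k = pval w.symm p := by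
    rintro k h1 h2 rfl
    rw [pval_symm_pval w h1 h2]
  unfold rk
  split_ifs with hp
  · rw [← Finset.card_insert_of_notMem (a := pval w.symm p) (by simp [g3])]
    congr 1
    ext k
    simp only [Finset.mem_filter, Finset.mem_Icc, Finset.mem_insert]
    constructor
    · rintro ⟨h1, h2, h3⟩
      by_cases hk : pval w k = p
      · exact Or.inl (key k h1.1 h1.2 hk)
      · exact Or.inr ⟨h1, h2, by omega⟩
    · rintro (rfl | ⟨h1, h2, h3⟩)
      · exact ⟨⟨g1, g2⟩, hp, g3.ge⟩
      · exact ⟨h1, h2, by omega⟩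
  · refine (congrArg Finset.card ?_).trans (Nat.add_zero _).symm
    ext k
    simp only [Finset.mem_filter, Finset.mem_Icc]
    constructor
    · rintro ⟨h1, h2, h3⟩
      refine ⟨h1, h2, ?_⟩
      by_contra hk
      have := key k h1.1 h1.2 (by omega)
      omega
    · rintro ⟨h1, h2, h3⟩
      exact ⟨h1, h2, by omega⟩

theorem rk_mono {p p' q q' : ℕ} (hp : p' ≤ p) (hq : q ≤ q') : rk w p q ≤ rk w p' q' := by
  refine Finset.card_le_card fun k hk => ?_
  simp only [Finset.mem_filter] at hk ⊢
  exact ⟨hk.1, hk.2.1.trans hq, hp.trans hk.2.2⟩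

theorem rk_zero_right (p : ℕ) : rk w p 0 = 0 := by
  simp only [rk, Finset.card_eq_zero, Finset.filter_eq_empty_iff, Finset.mem_Icc]
  omega

theorem rk_eq_zero_of_lt {p : ℕ} (hp : n < p) (q : ℕ) : rk w p q = 0 := by
  simp only [rk, Finset.card_eq_zero, Finset.filter_eq_empty_iff, Finset.mem_Icc]
  rintro k ⟨h1, h2⟩
  have := pval_mem_Icc w h1 h2
  omega

theorem rk_eq_zero_of_CondA {p q : ℕ} (h : CondA w p q) : rk w p q = 0 := by
  simp only [rk, Finset.card_eq_zero, Finset.filter_eq_empty_iff, Finset.mem_Icc]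
  rintro k ⟨h1, h2⟩ ⟨h3, h4⟩
  exact h ⟨k, h1, h2, h3, h4⟩

theorem rk_of_forall_col {p c q : ℕ} (hcq : c ≤ q) (hq : q ≤ n)
    (h : ∀ k, c < k → k ≤ q → p ≤ pval w k) : rk w p q = rk w p c + (q - c) := by
  induction q, hcq using Nat.le_induction with
  | base => simp
  | succ q hcq ih =>
    rw [rk_succ_right w hq, if_pos (h _ (by omega) le_rfl),
      ih (by omega) fun k h1 h2 => h k h1 (by omega)]
    omega

theorem rk_eq_of_forall_col {p c q : ℕ} (hcq : c ≤ q) (hq : q ≤ n)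
    (h : ∀ k, c < k → k ≤ q → pval w k < p) : rk w p q = rk w p c := by
  induction q, hcq using Nat.le_induction with
  | base => simp
  | succ q hcq ih =>
    rw [rk_succ_right w hq, if_neg (not_le.2 (h _ (by omega) le_rfl)),
      ih (by omega) fun k h1 h2 => h k h1 (by omega), Nat.add_zero]

theorem rk_of_forall_row {p d q : ℕ} (hpd : p ≤ d) (hp : 1 ≤ p) (hd : d ≤ n + 1)
    (h : ∀ x, p ≤ x → x < d → pval w.symm x ≤ q) : rk w p q = rk w d q + (d - p) := by
  induction d, hpd using Nat.le_induction with
  | base => simp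
  | succ d hpd ih =>
    rw [ih (by omega) fun k h1 h2 => h k h1 (by omega),
      rk_eq_rk_succ_left w (p := d) (by omega) (by omega), if_pos (h _ hpd (by omega))]
    omega

theorem rk_eq_of_forall_row {p d q : ℕ} (hpd : p ≤ d) (hp : 1 ≤ p) (hd : d ≤ n + 1)
    (h : ∀ x, p ≤ x → x < d → q < pval w.symm x) : rk w p q = rk w d q := by
  induction d, hpd using Nat.le_induction with
  | base => simp
  | succ d hpd ih =>
    rw [ih (by omega) fun k h1 h2 => h k h1 (by omega),
      rk_eq_rk_succ_left w (p := d) (by omega) (by omega),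
      if_neg (not_le.2 (h _ hpd (by omega))), Nat.add_zero]

/-- The number of `k` with `w(k) < p` is `p - 1`. -/
theorem card_filter_pval_lt {p : ℕ} (hp : 1 ≤ p) (hpn : p ≤ n + 1) :
    ((Finset.Icc 1 n).filter fun k => pval w k < p).card = p - 1 := by
  rw [← Nat.add_sub_cancel (n := p - 1) (m := 1), ← Nat.card_Icc]
  refine Finset.card_bij' (fun k _ => pval w k) (fun k _ => pval w.symm k) ?_ ?_ ?_ ?_
  · intro k hk
    simp only [Finset.mem_filter, Finset.mem_Icc] at hk ⊢
    have := pval_mem_Icc w hk.1.1 hk.1.2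
    omega
  · intro k hk
    simp only [Finset.mem_filter, Finset.mem_Icc] at hk ⊢
    rw [pval_pval_symm w (by omega) (by omega)]
    have := pval_mem_Icc w.symm (k := k) (by omega) (by omega)
    omega
  · intro k hk
    simp only [Finset.mem_filter, Finset.mem_Icc] at hk
    exact pval_symm_pval w hk.1.1 hk.1.2
  · intro k hk
    simp only [Finset.mem_Icc] at hk
    exact pval_pval_symm w (by omega) (by omega)

theorem rk_add_of_CondB {p q : ℕ} (hp : 1 ≤ p) (hpn : p ≤ n + 1) (hq : q ≤ n)
    (h : CondB w p q) : rk w p q + p = q + 1 := by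
  have h1 := Finset.card_filter_add_card_filter_not
    (s := (Finset.Icc 1 n).filter fun k => k ≤ q) (fun k => p ≤ pval w k)
  rw [Finset.filter_filter, Finset.filter_filter] at h1
  have h2 : ((Finset.Icc 1 n).filter fun k => k ≤ q) = Finset.Icc 1 q := by
    ext k
    simp only [Finset.mem_filter, Finset.mem_Icc]
    omega
  have h3 : ((Finset.Icc 1 n).filter fun k => k ≤ q ∧ ¬ p ≤ pval w k) =
      (Finset.Icc 1 n).filter fun k => pval w k < p := by
    refine Finset.filter_congr fun k hk => ?_
    rw [Finset.mem_Icc] at hk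
    refine ⟨fun h => not_le.1 h.2, fun h' => ⟨?_, not_le.2 h'⟩⟩
    by_contra hkq
    exact h ⟨k, hk.1, hk.2, by omega, h'⟩
  rw [h2, h3, card_filter_pval_lt w hp hpn, Nat.card_Icc] at h1
  unfold rk
  omega

/-- Every box of the diagram can be moved up to the top of its vertical run of boxes. -/
theorem exists_top {p q : ℕ} (h : (p, q) ∈ Diagram w) :
    ∃ a ≤ p, (∀ x, a ≤ x → x ≤ p → (x, q) ∈ Diagram w) ∧ (a - 1, q) ∉ Diagram w := by
  classical
  have hex : ∃ a, a ≤ p ∧ ∀ x, a ≤ x → x ≤ p → (x, q) ∈ Diagram w :=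
    ⟨p, le_rfl, fun x h1 h2 => by rwa [le_antisymm h2 h1]⟩
  obtain ⟨h1, h2⟩ := Nat.find_spec hex
  refine ⟨Nat.find hex, h1, h2, fun h3 => ?_⟩
  have h4 : 1 ≤ Nat.find hex - 1 := h3.1
  refine Nat.find_min hex (m := Nat.find hex - 1) (by omega) ⟨by omega, fun x h5 h6 => ?_⟩
  rcases h5.eq_or_lt with rfl | h5
  · exact h3
  · exact h2 x (by omega) h6

/-- Every box of the diagram can be moved right to the end of its horizontal run of boxes. -/
theorem exists_rightmost {p q : ℕ} (h : (p, q) ∈ Diagram w) :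
    ∃ b, q ≤ b ∧ (∀ y, q ≤ y → y ≤ b → (p, y) ∈ Diagram w) ∧ (p, b + 1) ∉ Diagram w := by
  classical
  have hex : ∃ b, q ≤ b ∧ (p, b + 1) ∉ Diagram w :=
    ⟨n, h.2.2.2.1, fun h' => by have : n + 1 ≤ n := h'.2.2.2.1; omega⟩
  obtain ⟨h1, h2⟩ := Nat.find_spec hex
  refine ⟨Nat.find hex, h1, fun y h3 h4 => ?_, h2⟩
  rcases h3.eq_or_lt with rfl | h3
  · exact h
  · by_contra h5
    refine Nat.find_min hex (m := y - 1) (by omega) ⟨by omega, ?_⟩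
    rwa [Nat.sub_add_cancel (by omega)]

theorem pval_eq_iff {k l : ℕ} (hk : 1 ≤ k) (hk' : k ≤ n) (hl : 1 ≤ l) (hl' : l ≤ n) :
    pval w k = l ↔ pval w.symm l = k := by
  constructor
  · rintro rfl
    exact pval_symm_pval w hk hk'
  · rintro rfl
    exact pval_pval_symm w hl hl'

end Combinatorics

section AlmostDefined

variable {n : ℕ} {w : Equiv.Perm (Fin n)}

theorem exists_box_of_CondW (hw : AlmostDBI w) {p q : ℕ} (hpq : (p, q) ∈ EssSet'' w)
    (hW : CondW w p q) :
    rk w p q + 1 = q ∨ ∃ a b, (a, b) ∈ EssSet w \ EssSet'' w ∧ a ≤ p ∧ b ≤ q ∧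
      ((CondB w a b ∧ a + rk w p q = q) ∨ (CondA w a b ∧ b + rk w p q + 1 = q)) := by
  obtain ⟨⟨hD, hR, hT⟩, hA, hB⟩ := hpq
  simp only at hD hR hT hA hB
  obtain ⟨hp1, hpn, hq1, hqn, hfq, hgp⟩ := id hD
  simp only at hp1 hpn hq1 hqn hfq hgp
  have hg1 := pval_mem_Icc w.symm hp1 hpn
  obtain ⟨hW1, hW2⟩ := hW
  have hrq : rk w p q = rk w p (q - 1) := by
    have := rk_succ_right w (p := p) (q := q - 1) (by omega)
    rw [Nat.sub_add_cancel hq1, if_neg (not_le.2 hfq)] at this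
    exact this
  by_cases hD' : (p, q - 1) ∈ Diagram w
  · rcases hW2 with h | ⟨a, ha, haE, haB, har⟩
    · exact absurd hD' h
    have ha1 : 1 ≤ a := haE.1.1
    have := rk_add_of_CondB w ha1 (by omega) (by omega) haB
    exact Or.inr ⟨a, q - 1, ⟨haE, fun h => h.2.2 haB⟩, ha.le, by omega,
      Or.inl ⟨haB, by omega⟩⟩
  -- the boxes of column `q` above `p` are not in the diagram
  have hcol : ∀ x < p, (x, q) ∉ Diagram w := by
    intro x hx hxD
    obtain ⟨a, hax, hrun, htop⟩ := exists_top w hxD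
    refine hW1 a (by omega) ⟨hrun a le_rfl hax, fun hr => hR ?_, htop⟩
    have h1 : q + 1 ≤ n := hr.2.2.2.1
    have h2 : pval w (q + 1) < a := hr.2.2.2.2.1
    refine ⟨hp1, hpn, by omega, h1, by simp only; omega, ?_⟩
    simp only
    by_contra h3
    have h4 : pval w.symm p = q + 1 := by omega
    have := (pval_eq_iff w (by omega) h1 hp1 hpn).2 h4
    omega
  -- the last column `c` before `q` with `w(c) < p`
  let P : ℕ → Prop := fun c => pval w c < p
  have hP0 : P 0 := by simp only [P, pval]; simpa using Nat.lt_of_succ_le hp1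
  classical
  obtain ⟨c, hc⟩ : ∃ c, c = Nat.findGreatest P (q - 1) := ⟨_, rfl⟩
  have hcP : pval w c < p := by
    rw [hc]; exact Nat.findGreatest_spec (P := P) (Nat.zero_le _) hP0
  have hcq : c ≤ q - 1 := hc ▸ Nat.findGreatest_le _
  have hck : ∀ k, c < k → k ≤ q - 1 → p ≤ pval w k := by
    intro k h1 h2
    exact not_lt.1 (Nat.findGreatest_is_greatest (P := P) (hc ▸ h1) h2)
  have hrc : rk w p (q - 1) = rk w p c + (q - 1 - c) :=
    rk_of_forall_col w hcq (by omega) hck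
  rcases Nat.eq_zero_or_pos c with rfl | hc0
  · left
    rw [rk_zero_right] at hrc
    omega
  have hcq' : c < q - 1 := by
    rcases hcq.eq_or_lt with h | h
    · refine absurd ⟨hp1, hpn, ?_, ?_, ?_, ?_⟩ hD' <;> simp only
      · omega
      · omega
      · rwa [← h]
      · omega
    · exact h
  right
  have hcD : (p, c) ∈ Diagram w :=
    (mem_Diagram w).2 ⟨hp1, hpn, by omega, by omega, hcP, by omega⟩
  obtain ⟨a, hap, hrun, htop⟩ := exists_top w hcD
  have hc1 := hck (c + 1) (by omega) (by omega)
  have hnR : ∀ x ≤ p, ∀ y, c < y → y ≤ q - 1 → (x, y) ∉ Diagram w := by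
    intro x hx y h1 h2 hxy
    have h3 : pval w y < x := hxy.2.2.2.2.1
    have := hck y h1 h2
    omega
  have haE : (a, c) ∈ EssSet w :=
    ⟨hrun a le_rfl hap, hnR a hap (c + 1) (by omega) (by omega), htop⟩
  have ha1 : 1 ≤ a := haE.1.1
  have hra : rk w a c = rk w p c :=
    rk_eq_of_forall_row w hap ha1 (by omega) fun x h1 h2 => (hrun x h1 (by omega)).2.2.2.2.2
  refine ⟨a, c, ?_⟩
  by_cases haA : CondA w a c
  · have := rk_eq_zero_of_CondA w haA
    exact ⟨⟨haE, fun h => h.2.1 haA⟩, hap, by omega, Or.inr ⟨haA, by omega⟩⟩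
  by_cases haB : CondB w a c
  · have := rk_add_of_CondB w ha1 (by omega) (by omega) haB
    exact ⟨⟨haE, fun h => h.2.2 haB⟩, hap, by omega, Or.inl ⟨haB, by omega⟩⟩
  exfalso
  have hYZ := ((hw a c haE).resolve_left (not_or.2 ⟨haA, haB⟩)).2
  rcases hap.eq_or_lt with rfl | hap
  · rcases hYZ with hY | ⟨b, hb, hbE, hbu, hbB, -⟩
    · exact hY.1 q (by omega) ⟨hD, hR, hT⟩
    · rw [hbu q (by omega) ⟨hD, hR, hT⟩] at hB
      exact hB hbB
  have hafq : a ≤ pval w q := by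
    by_contra h
    refine hcol a hap ((mem_Diagram w).2 ⟨ha1, by omega, hq1, hqn, by omega, ?_⟩)
    have h1 : c < pval w.symm a := (hrun a le_rfl hap.le).2.2.2.2.2
    have hga := pval_pval_symm w ha1 (by omega)
    by_contra h2
    rcases (not_lt.1 h2).eq_or_lt with h3 | h3
    · rw [h3] at hga
      omega
    · have := hck _ h1 (by omega)
      omega
  have hac := rk_of_forall_col w hcq (by omega) (p := a) fun k h1 h2 => hap.le.trans (hck k h1 h2)
  rcases hYZ with ⟨-, hY⟩ | ⟨b, hb, hbE, -, -, hbr, -⟩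
  · rcases hY with hY | ⟨b, hb, -, -, hbr⟩
    · exact hY (hrun _ (by omega) (by omega))
    · have h1 := rk_mono w (le_refl (a + 1)) (show c + 1 ≤ b from hb)
      have h2 := rk_succ_right w (p := a + 1) (q := c) (by omega)
      rw [if_pos (by omega)] at h2
      have h3 := rk_eq_rk_succ_left w (q := c) ha1 (by omega)
      rw [if_neg (not_le.2 (hrun a le_rfl hap.le).2.2.2.2.2)] at h3
      omega
  · have hbq : q ≤ b := by
      by_contra h
      exact hnR a hap.le b hb (by omega) hbE.1
    have h1 := rk_mono w (le_refl a) hbq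
    have h2 := rk_succ_right w (p := a) (q := q - 1) (by omega)
    rw [Nat.sub_add_cancel hq1, if_pos hafq] at h2
    omega

theorem exists_box_of_CondX {p q : ℕ} (hpq : (p, q) ∈ EssSet'' w) (hX : CondX w p q) :
    ∃ a b, (a, b) ∈ EssSet w \ EssSet'' w ∧ a ≤ p ∧ b ≤ q ∧
      CondB w a b ∧ a + rk w p q = q := by
  obtain ⟨a, ha, haE, -, haB, har, -⟩ := hX
  have ha1 : 1 ≤ a := haE.1.1
  have hpn : p ≤ n := hpq.1.1.2.1
  have hqn : q ≤ n := hpq.1.1.2.2.2.1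
  have := rk_add_of_CondB w ha1 (by omega) hqn haB
  exact ⟨a, q, ⟨haE, fun h => h.2.2 haB⟩, ha.le, le_rfl, haB, by omega⟩

theorem exists_box_of_CondY (hw : AlmostDBI w) {p q : ℕ} (hpq : (p, q) ∈ EssSet'' w)
    (hY : CondY w p q) :
    p + rk w p q = n ∨ ∃ a b, (a, b) ∈ EssSet w \ EssSet'' w ∧ p ≤ a ∧ q ≤ b ∧
      ((CondB w a b ∧ b = p + rk w p q) ∨ (CondA w a b ∧ a = p + rk w p q + 1)) := by
  obtain ⟨⟨hD, hR, hT⟩, hA, hB⟩ := hpq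
  simp only at hD hR hT hA hB
  obtain ⟨hp1, hpn, hq1, hqn, hfq, hgp⟩ := id hD
  simp only at hp1 hpn hq1 hqn hfq hgp
  have hg1 := pval_mem_Icc w.symm hp1 hpn
  obtain ⟨hY1, hY2⟩ := hY
  have hrq : rk w p q = rk w (p + 1) q := by
    have := rk_eq_rk_succ_left w (q := q) hp1 hpn
    rwa [if_neg (not_le.2 hgp)] at this
  by_cases hD' : (p + 1, q) ∈ Diagram w
  · rcases hY2 with h | ⟨b, hb, hbE, hbB, hbr⟩
    · exact absurd hD' h
    have hbn : b ≤ n := hbE.1.2.2.2.1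
    have := rk_add_of_CondB w (by omega) (by omega) hbn hbB
    exact Or.inr ⟨p + 1, b, ⟨hbE, fun h => h.2.2 hbB⟩, by omega, le_of_lt hb,
      Or.inl ⟨hbB, by omega⟩⟩
  -- the boxes of row `p` to the right of `q` are not in the diagram
  have hrow : ∀ y > q, (p, y) ∉ Diagram w := by
    intro y hy hyD
    obtain ⟨b, hyb, hrun, hright⟩ := exists_rightmost w hyD
    refine hY1 b (by omega) ⟨hrun b hyb le_rfl, hright, fun ht => hT ?_⟩
    have h1 : 1 ≤ p - 1 := ht.1
    have h2 : b < pval w.symm (p - 1) := ht.2.2.2.2.2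
    refine (mem_Diagram w).2 ⟨h1, by omega, hq1, hqn, ?_, by omega⟩
    by_contra h3
    have h4 : pval w q = p - 1 := by omega
    have := (pval_eq_iff w hq1 hqn h1 (by omega)).1 h4
    omega
  -- the first row `d` after `p` with `w⁻¹(d) > q`
  have hex : ∃ d, p < d ∧ (d ≤ n → q < pval w.symm d) :=
    ⟨n + 1, by omega, fun h => by omega⟩
  classical
  obtain ⟨d, hd⟩ : ∃ d, d = Nat.find hex := ⟨_, rfl⟩
  obtain ⟨hpd, hdP⟩ := Nat.find_spec hex
  rw [← hd] at hpd hdP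
  have hdn : d ≤ n + 1 := hd ▸ Nat.find_min' hex ⟨by omega, fun h => by omega⟩
  have hdx : ∀ x, p + 1 ≤ x → x < d → pval w.symm x ≤ q := by
    intro x h1 h2
    by_contra h3
    exact Nat.find_min hex (hd ▸ h2) ⟨h1, fun _ => not_le.1 h3⟩
  have hrd : rk w (p + 1) q = rk w d q + (d - (p + 1)) :=
    rk_of_forall_row w hpd (by omega) hdn hdx
  rcases hdn.eq_or_lt with h | hdn
  · left
    rw [rk_eq_zero_of_lt w (by omega : n < d)] at hrd
    omega
  replace hdP := hdP (by omega)
  have hpd' : p + 1 < d := by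
    rcases (Nat.succ_le_of_lt hpd).eq_or_lt with h | h
    · refine absurd ((mem_Diagram w).2 ⟨?_, ?_, hq1, hqn, ?_, ?_⟩) hD'
      · omega
      · omega
      · omega
      · rwa [show p + 1 = d from h]
    · exact h
  right
  have hdD : (d, q) ∈ Diagram w :=
    (mem_Diagram w).2 ⟨by omega, by omega, hq1, hqn, by omega, hdP⟩
  obtain ⟨b, hqb, hrun, hright⟩ := exists_rightmost w hdD
  have hnT : ∀ y, q ≤ y → ∀ x, p < x → x < d → (x, y) ∉ Diagram w := by
    intro y hy x h1 h2 hxy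
    have h3 : y < pval w.symm x := hxy.2.2.2.2.2
    have := hdx x h1 h2
    omega
  have hbE : (d, b) ∈ EssSet w :=
    ⟨hrun b hqb le_rfl, hright, hnT b hqb (d - 1) (by omega) (by omega)⟩
  have hbn : b ≤ n := hbE.1.2.2.2.1
  have hrb : rk w d b = rk w d q :=
    rk_eq_of_forall_col w hqb hbn fun x h1 h2 => (hrun x (by omega) h2).2.2.2.2.1
  refine ⟨d, b, ?_⟩
  by_cases hbA : CondA w d b
  · have := rk_eq_zero_of_CondA w hbA
    exact ⟨⟨hbE, fun h => h.2.1 hbA⟩, hpd.le, hqb, Or.inr ⟨hbA, by omega⟩⟩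
  by_cases hbB : CondB w d b
  · have := rk_add_of_CondB w (by omega) (by omega) hbn hbB
    exact ⟨⟨hbE, fun h => h.2.2 hbB⟩, hpd.le, hqb, Or.inl ⟨hbB, by omega⟩⟩
  exfalso
  have hWX := ((hw d b hbE).resolve_left (not_or.2 ⟨hbA, hbB⟩)).1
  rcases hqb.eq_or_lt with rfl | hqb
  · rcases hWX with hW | ⟨a, ha, haE, hau, haB, -⟩
    · exact hW.1 p hpd ⟨hD, hR, hT⟩
    · rw [hau p hpd ⟨hD, hR, hT⟩] at hB
      exact hB haB
  have hgpb : pval w.symm p ≤ b := by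
    by_contra h
    refine hrow b hqb ((mem_Diagram w).2 ⟨hp1, hpn, by omega, hbn, ?_, by omega⟩)
    have h1 : pval w b < d := (hrun b hqb.le le_rfl).2.2.2.2.1
    have hfb := pval_symm_pval w (by omega : 1 ≤ b) hbn
    by_contra h2
    rcases (not_lt.1 h2).eq_or_lt with h3 | h3
    · rw [← h3] at hfb
      omega
    · have := hdx _ h3 h1
      omega
  have hdb : rk w (p + 1) b = rk w d b + (d - (p + 1)) :=
    rk_of_forall_row w hpd (by omega) (by omega) fun x h1 h2 => (hdx x h1 h2).trans hqb.le
  rcases hWX with ⟨-, hW⟩ | ⟨a, ha, haE, -, -, har, -⟩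
  · rcases hW with hW | ⟨a, ha, -, -, har⟩
    · exact hW (hrun _ (by omega) (by omega))
    · have h1 := rk_mono w (show a ≤ d - 1 by omega) (le_refl (b - 1))
      have h2 := rk_eq_rk_succ_left w (p := d - 1) (q := b - 1) (by omega) (by omega)
      have h4 := hdx (d - 1) (by omega) (by omega)
      rw [Nat.sub_add_cancel (by omega), if_pos (by omega)] at h2
      have h3 := rk_succ_right w (p := d) (q := b - 1) (by omega)
      rw [Nat.sub_add_cancel (by omega),
        if_neg (not_le.2 (hrun b hqb.le le_rfl).2.2.2.2.1)] at h3
      omega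
  · have hap : a ≤ p := by
      by_contra h
      exact hnT b hqb.le a (by omega) ha haE.1
    have h1 := rk_mono w hap (le_refl b)
    have h2 := rk_eq_rk_succ_left w (q := b) hp1 hpn
    rw [if_pos hgpb] at h2
    omega

theorem exists_box_of_CondZ {p q : ℕ} (hpq : (p, q) ∈ EssSet'' w) (hZ : CondZ w p q) :
    ∃ a b, (a, b) ∈ EssSet w \ EssSet'' w ∧ p ≤ a ∧ q ≤ b ∧
      CondB w a b ∧ b = p + rk w p q := by
  obtain ⟨b, hb, hbE, -, hbB, hbr, -⟩ := hZ
  have hp1 : 1 ≤ p := hpq.1.1.1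
  have hpn : p ≤ n := hpq.1.1.2.1
  have hbn : b ≤ n := hbE.1.2.2.2.1
  have := rk_add_of_CondB w hp1 (by omega) hbn hbB
  exact ⟨p, b, ⟨hbE, fun h => h.2.2 hbB⟩, le_rfl, le_of_lt hb, hbB, by omega⟩

end AlmostDefined

section Minors

open Matrix

variable {n : ℕ}

theorem dminor_eq_det {m : ℕ} {A B : Finset ℕ} (hA : A.card = m) (hB : B.card = m) :
    dminor n A B = det (of fun i j : Fin m =>
      Mmat n (A.orderEmbOfFin hA i) (B.orderEmbOfFin hB j)) := by
  subst hA
  rw [dminor, dif_pos hB]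
  rfl

theorem Mmat_self {i : ℕ} (h : 1 ≤ i) (h' : i ≤ n) : Mmat n i i = 1 := by
  simp [Mmat, h, h']

theorem Mmat_of_lt {i j : ℕ} (h : i < j) : Mmat n i j = 0 := by
  rw [Mmat, if_neg (by omega), zvar, dif_neg (by omega)]

theorem exists_equiv_fin_orderEmbOfFin {ι : Type*} [Fintype ι] {m : ℕ}
    (hι : Fintype.card ι = m) {f : ι → ℕ} (hf : Function.Injective f)
    (hc : (Finset.univ.image f).card = m) :
    ∃ e : ι ≃ Fin m, ∀ i, (Finset.univ.image f).orderEmbOfFin hc (e i) = f i := by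
  have h : ∀ i, ∃ t, (Finset.univ.image f).orderEmbOfFin hc t = f i := by
    intro i
    have : f i ∈ Set.range ((Finset.univ.image f).orderEmbOfFin hc) := by
      rw [Finset.range_orderEmbOfFin]
      simp
    exact this
  choose e he using h
  have hinj : Function.Injective e := fun i j hij => hf (by rw [← he i, ← he j, hij])
  exact ⟨Equiv.ofBijective e
    ((Fintype.bijective_iff_injective_and_card e).2 ⟨hinj, by simp [hι]⟩), he⟩

variable {Q : Type*} [CommRing Q] (φ : PolyS n →+* Q)

/-- If `φ` kills `I_{(a,b,s)}`, it kills every minor of size `s + 1` of the corresponding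
submatrix, however its rows and columns are listed. -/
theorem det_eq_zero_of_Iideal_le_ker {a b s : ℕ} (h : Iideal n a b s ≤ RingHom.ker φ)
    {ι : Type*} [Fintype ι] [DecidableEq ι] (hι : Fintype.card ι = s + 1) (f g : ι → ℕ)
    (hf : ∀ i, f i ∈ Finset.Icc a n) (hg : ∀ i, g i ∈ Finset.Icc 1 b) :
    det (of fun i j => φ (Mmat n (f i) (g j))) = 0 := by
  by_cases hfi : Function.Injective f
  swap
  · simp only [Function.Injective, not_forall] at hfi
    obtain ⟨i, j, hij, hne⟩ := hfi
    exact det_zero_of_row_eq hne (by ext k; simp [hij])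
  by_cases hgi : Function.Injective g
  swap
  · simp only [Function.Injective, not_forall] at hgi
    obtain ⟨i, j, hij, hne⟩ := hgi
    exact det_zero_of_column_eq hne (by intro k; simp [hij])
  have hA : (Finset.univ.image f).card = s + 1 := by
    rw [Finset.card_image_of_injective _ hfi, Finset.card_univ, hι]
  have hB : (Finset.univ.image g).card = s + 1 := by
    rw [Finset.card_image_of_injective _ hgi, Finset.card_univ, hι]
  obtain ⟨e, he⟩ := exists_equiv_fin_orderEmbOfFin hι hfi hA
  obtain ⟨e', he'⟩ := exists_equiv_fin_orderEmbOfFin hι hgi hB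
  have h0 : φ (dminor n (Finset.univ.image f) (Finset.univ.image g)) = 0 := by
    refine h (Ideal.subset_span ⟨_, _, hA, hB, ?_, ?_, rfl⟩)
    · simpa [Finset.image_subset_iff] using hf
    · simpa [Finset.image_subset_iff] using hg
  rw [dminor_eq_det hA hB] at h0
  set D : Matrix (Fin (s + 1)) (Fin (s + 1)) (PolyS n) := of fun i j =>
    Mmat n ((Finset.univ.image f).orderEmbOfFin hA i)
      ((Finset.univ.image g).orderEmbOfFin hB j) with hD
  have h1 : (of fun i j => φ (Mmat n (f i) (g j))) =
      ((φ.mapMatrix D).submatrix id (e.symm.trans e')).submatrix e e := by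
    ext i j
    simp [hD, he, he']
  rw [h1, det_submatrix_equiv_self, det_permute', ← RingHom.map_det, h0, mul_zero]

theorem det_Mmat_Icc {a b : ℕ} (ha : 1 ≤ a) (hb : b ≤ n) :
    det (of fun i j : Finset.Icc a b => φ (Mmat n i j)) = 1 := by
  rw [det_of_isLowerTriangular]
  · refine Finset.prod_eq_one fun i _ => ?_
    have := Finset.mem_Icc.1 i.2
    rw [of_apply, Mmat_self (by omega) (by omega), map_one]
  · intro i j hij
    have hij' : (i : ℕ) < j := hij
    rw [of_apply, Mmat_of_lt hij', map_zero]

/-- Where the rank condition at `(a,b)` is the one forced by the unitriangular block on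
`{a,…,b}`, the whole submatrix factors through that block. -/
theorem exists_factor_of_Iideal_le_ker {a b s : ℕ} (h : Iideal n a b s ≤ RingHom.ker φ)
    (ha : 1 ≤ a) (hb : b ≤ n) (hs : s + a = b + 1) :
    ∃ G : ℕ → ℕ → Q, ∀ i ∈ Finset.Icc a n, ∀ j ∈ Finset.Icc 1 b,
      φ (Mmat n i j) = ∑ k ∈ Finset.Icc a b, ∑ l ∈ Finset.Icc a b,
        φ (Mmat n i k) * G k l * φ (Mmat n l j) := by
  let T : Matrix (Finset.Icc a b) (Finset.Icc a b) Q := of fun i j => φ (Mmat n i j)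
  have hT : det T = 1 := det_Mmat_Icc φ ha hb
  have hTu : IsUnit T := (isUnit_iff_isUnit_det T).2 (hT ▸ isUnit_one)
  let := hTu.invertible
  refine ⟨fun k l => if h : k ∈ Finset.Icc a b ∧ l ∈ Finset.Icc a b then
    (⅟T) ⟨k, h.1⟩ ⟨l, h.2⟩ else 0, fun i hi j hj => ?_⟩
  let f : Finset.Icc a b ⊕ Unit → ℕ := Sum.elim (fun k => k) fun _ => i
  let g : Finset.Icc a b ⊕ Unit → ℕ := Sum.elim (fun k => k) fun _ => j
  let U : Matrix (Finset.Icc a b) Unit Q := of fun k _ => φ (Mmat n k j)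
  let V : Matrix Unit (Finset.Icc a b) Q := of fun _ k => φ (Mmat n i k)
  let X : Matrix Unit Unit Q := of fun _ _ => φ (Mmat n i j)
  have h0 := det_eq_zero_of_Iideal_le_ker φ h (by simp; omega) f g
    (by
      rintro (k | _)
      · have := Finset.mem_Icc.1 k.2
        simp only [f, Sum.elim_inl, Finset.mem_Icc]
        omega
      · exact hi)
    (by
      rintro (k | _)
      · have := Finset.mem_Icc.1 k.2
        simp only [g, Sum.elim_inl, Finset.mem_Icc]
        omega
      · exact hj)
  have h1 : (of fun i j => φ (Mmat n (f i) (g j))) = fromBlocks T U V X := by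
    ext (_ | _) (_ | _) <;> rfl
  rw [h1, det_fromBlocks₁₁, hT, one_mul, det_unique, Matrix.sub_apply, sub_eq_zero] at h0
  have h2 : φ (Mmat n i j) = (V * ⅟T * U) default default := h0
  rw [h2, Matrix.mul_assoc, Matrix.mul_apply, ← Finset.sum_coe_sort (Finset.Icc a b)]
  refine Finset.sum_congr rfl fun k _ => ?_
  rw [Matrix.mul_apply, Finset.mul_sum, ← Finset.sum_coe_sort (Finset.Icc a b)]
  refine Finset.sum_congr rfl fun l _ => ?_
  simp only [k.2, l.2, and_self, dite_true, Subtype.coe_eta, mul_assoc]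
  rfl

theorem Mmat_mem_of_Iideal_le_ker {a b : ℕ} (h : Iideal n a b 0 ≤ RingHom.ker φ)
    {i j : ℕ} (hi : i ∈ Finset.Icc a n) (hj : j ∈ Finset.Icc 1 b) : φ (Mmat n i j) = 0 := by
  have := det_eq_zero_of_Iideal_le_ker φ h (ι := Unit) (by simp) (fun _ => i) (fun _ => j)
    (fun _ => hi) (fun _ => hj)
  simpa using this

/-- If the columns in `{1,…,q}` of the rows in `{p,…,n}` are combinations of the columns in
`C`, and the rows are combinations of those in `P`, then vanishing of the minor on `P × C`
forces vanishing of all minors of that size. -/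
theorem dminor_map_eq_zero {p q m : ℕ} {P C : Finset ℕ} (hP : P.card = m) (hC : C.card = m)
    (hCq : C ⊆ Finset.Icc 1 q) (h0 : φ (dminor n P C) = 0)
    (hcol : ∀ j ∈ Finset.Icc 1 q, ∃ c : ℕ → Q, ∀ i ∈ Finset.Icc p n,
      φ (Mmat n i j) = ∑ k ∈ C, φ (Mmat n i k) * c k)
    (hrow : ∀ i ∈ Finset.Icc p n, ∃ c : ℕ → Q, ∀ j ∈ Finset.Icc 1 q,
      φ (Mmat n i j) = ∑ k ∈ P, c k * φ (Mmat n k j))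
    {A B : Finset ℕ} (hA : A.card = m) (hB : B.card = m) (hAp : A ⊆ Finset.Icc p n)
    (hBq : B ⊆ Finset.Icc 1 q) : φ (dminor n A B) = 0 := by
  choose! F hF using hcol
  choose! E hE using hrow
  have sum_fin : ∀ {K : Finset ℕ} (hK : K.card = m) (x : ℕ → Q),
      ∑ k ∈ K, x k = ∑ t : Fin m, x (K.orderEmbOfFin hK t) := by
    intro K hK x
    conv_lhs => rw [← Finset.map_orderEmbOfFin_univ K hK, Finset.sum_map]
    rfl
  have key : φ.mapMatrix (of fun i j : Fin m =>
      Mmat n (A.orderEmbOfFin hA i) (B.orderEmbOfFin hB j)) =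
      (of fun i k : Fin m => E (A.orderEmbOfFin hA i) (P.orderEmbOfFin hP k)) *
      φ.mapMatrix (of fun i j : Fin m =>
        Mmat n (P.orderEmbOfFin hP i) (C.orderEmbOfFin hC j)) *
      (of fun k j : Fin m => F (B.orderEmbOfFin hB j) (C.orderEmbOfFin hC k)) := by
    ext i j
    have hi := hAp (A.orderEmbOfFin_mem hA i)
    have hj := hBq (B.orderEmbOfFin_mem hB j)
    simp only [RingHom.mapMatrix_apply, map_apply, of_apply, Matrix.mul_apply]
    rw [hF _ hj _ hi, sum_fin hC]
    refine Finset.sum_congr rfl fun k _ => ?_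
    rw [hE _ hi _ (hCq (C.orderEmbOfFin_mem hC k)), sum_fin hP]
  rw [dminor_eq_det hA hB, RingHom.map_det, key, det_mul, det_mul, ← RingHom.map_det,
    ← dminor_eq_det hP hC, h0, mul_zero, zero_mul]

theorem exists_col_of_mem {p j : ℕ} {C : Finset ℕ} (hj : j ∈ C) :
    ∃ c : ℕ → Q, ∀ i ∈ Finset.Icc p n,
      φ (Mmat n i j) = ∑ k ∈ C, φ (Mmat n i k) * c k :=
  ⟨Pi.single j 1, fun i _ => by simp [Pi.single_apply, hj]⟩

theorem exists_row_of_mem {i q : ℕ} {P : Finset ℕ} (hi : i ∈ P) :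
    ∃ c : ℕ → Q, ∀ j ∈ Finset.Icc 1 q,
      φ (Mmat n i j) = ∑ k ∈ P, c k * φ (Mmat n k j) :=
  ⟨Pi.single i 1, fun j _ => by simp [Pi.single_apply, hi]⟩

theorem exists_col_of_factor {a b p j s : ℕ} {C : Finset ℕ}
    (h : Iideal n a b s ≤ RingHom.ker φ) (ha : 1 ≤ a) (hb : b ≤ n) (hs : s + a = b + 1)
    (hap : a ≤ p) (hC : Finset.Icc a b ⊆ C) (hj : j ∈ Finset.Icc 1 b) :
    ∃ c : ℕ → Q, ∀ i ∈ Finset.Icc p n,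
      φ (Mmat n i j) = ∑ k ∈ C, φ (Mmat n i k) * c k := by
  obtain ⟨G, hG⟩ := exists_factor_of_Iideal_le_ker φ h ha hb hs
  refine ⟨fun k => if k ∈ Finset.Icc a b then
    ∑ l ∈ Finset.Icc a b, G k l * φ (Mmat n l j) else 0, fun i hi => ?_⟩
  rw [hG i (Finset.Icc_subset_Icc_left hap hi) j hj]
  refine Finset.sum_subset_zero_on_sdiff hC (fun k hk => ?_) fun k hk => ?_
  · simp only [if_neg (Finset.mem_sdiff.1 hk).2, mul_zero]
  · simp only [if_pos hk, Finset.mul_sum, mul_assoc]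

theorem exists_row_of_factor {a b q i s : ℕ} {P : Finset ℕ}
    (h : Iideal n a b s ≤ RingHom.ker φ) (ha : 1 ≤ a) (hb : b ≤ n) (hs : s + a = b + 1)
    (hqb : q ≤ b) (hP : Finset.Icc a b ⊆ P) (hi : i ∈ Finset.Icc a n) :
    ∃ c : ℕ → Q, ∀ j ∈ Finset.Icc 1 q,
      φ (Mmat n i j) = ∑ k ∈ P, c k * φ (Mmat n k j) := by
  obtain ⟨G, hG⟩ := exists_factor_of_Iideal_le_ker φ h ha hb hs
  refine ⟨fun l => if l ∈ Finset.Icc a b then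
    ∑ k ∈ Finset.Icc a b, φ (Mmat n i k) * G k l else 0, fun j hj => ?_⟩
  rw [hG i hi j (Finset.Icc_subset_Icc_right hqb hj), Finset.sum_comm]
  refine Finset.sum_subset_zero_on_sdiff hP (fun k hk => ?_) fun k hk => ?_
  · simp only [if_neg (Finset.mem_sdiff.1 hk).2, zero_mul]
  · simp only [if_pos hk, Finset.sum_mul]

end Minors

/-- Let `w` be almost defined by inclusions, `v` a permutation with
`E(v) = E(w) ∖ E″(w)` and matching ranks, `(p,q) ∈ E″(w)` and `r = r_w(p,q)`.  Then
`I_{(p,q,r)} ⊆ I_v + ⟨d_{{p,…,p+r},{q−r,…,q}}⟩`. -/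
theorem Iideal_le_Iv_add_extra {n : ℕ} (w v : Equiv.Perm (Fin n))
    (hw : AlmostDBI w)
    (hE : EssSet v = EssSet w \ EssSet'' w)
    (hr : ∀ pq ∈ EssSet v, rk v pq.1 pq.2 = rk w pq.1 pq.2)
    {p q : ℕ} (hpq : (p, q) ∈ EssSet'' w) :
    Iideal n p q (rk w p q) ≤
      Iw v + Ideal.span
        {dminor n (Finset.Icc p (p + rk w p q)) (Finset.Icc (q - rk w p q) q)} := by
  obtain ⟨hWX, hYZ⟩ := (hw p q hpq.1).resolve_left (not_or.2 hpq.2)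
  set r := rk w p q with hrdef
  set J := Iw v + Ideal.span {dminor n (Finset.Icc p (p + r)) (Finset.Icc (q - r) q)} with hJ
  let φ := Ideal.Quotient.mk J
  have hker : RingHom.ker φ = J := Ideal.mk_ker
  have hbox : ∀ a b, (a, b) ∈ EssSet w \ EssSet'' w →
      Iideal n a b (rk w a b) ≤ RingHom.ker φ := by
    intro a b hab
    rw [← hE] at hab
    have h1 : Iideal n a b (rk v a b) ≤ Iw v :=
      le_iSup₂_of_le (f := fun (pq : ℕ × ℕ) (_ : pq ∈ EssSet v) =>
        Iideal n pq.1 pq.2 (rk v pq.1 pq.2)) (a, b) hab le_rfl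
    rw [hr (a, b) hab] at h1
    rw [hker, hJ]
    exact h1.trans le_sup_left
  have h0 : φ (dminor n (Finset.Icc p (p + r)) (Finset.Icc (q - r) q)) = 0 := by
    rw [← RingHom.mem_ker, hker, hJ]
    exact Ideal.mem_sup_right (Ideal.mem_span_singleton_self _)
  obtain ⟨hp1, hpn, hq1, hqn, hfq, -⟩ := id hpq.1.1
  simp only at hp1 hpn hq1 hqn hfq
  have hrq : r + 1 ≤ q := by
    have h1 := rk_succ_right w (p := p) (q := q - 1) (by omega)
    rw [Nat.sub_add_cancel hq1, if_neg (not_le.2 hfq), ← hrdef] at h1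
    have h2 : rk w p (q - 1) ≤ (Finset.Icc 1 (q - 1)).card := by
      refine Finset.card_le_card fun k hk => ?_
      simp only [Finset.mem_filter, Finset.mem_Icc] at hk ⊢
      omega
    rw [Nat.card_Icc] at h2
    omega
  have hcolbox : r + 1 = q ∨ ∃ a b, (a, b) ∈ EssSet w \ EssSet'' w ∧ a ≤ p ∧ b ≤ q ∧
      ((CondB w a b ∧ a + r = q) ∨ (CondA w a b ∧ b + r + 1 = q)) := by
    rcases hWX with hW | hX
    · exact exists_box_of_CondW hw hpq hW
    · obtain ⟨a, b, hab, h1, h2, h3⟩ := exists_box_of_CondX hpq hX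
      exact Or.inr ⟨a, b, hab, h1, h2, Or.inl h3⟩
  have hrowbox : p + r = n ∨ ∃ a b, (a, b) ∈ EssSet w \ EssSet'' w ∧ p ≤ a ∧ q ≤ b ∧
      ((CondB w a b ∧ b = p + r) ∨ (CondA w a b ∧ a = p + r + 1)) := by
    rcases hYZ with hY | hZ
    · exact exists_box_of_CondY hw hpq hY
    · obtain ⟨a, b, hab, h1, h2, h3⟩ := exists_box_of_CondZ hpq hZ
      exact Or.inr ⟨a, b, hab, h1, h2, Or.inl h3⟩
  rw [Iideal, Ideal.span_le]
  rintro _ ⟨A, B, hA, hB, hAp, hBq, rfl⟩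
  rw [SetLike.mem_coe, ← hker, RingHom.mem_ker]
  refine dminor_map_eq_zero φ (p := p) (q := q) (m := r + 1)
    (by rw [Nat.card_Icc]; omega) (by rw [Nat.card_Icc]; omega)
    (Finset.Icc_subset_Icc_left (by omega)) h0 (fun j hj => ?_) (fun i hi => ?_) hA hB hAp hBq
  · by_cases hjC : j ∈ Finset.Icc (q - r) q
    · exact exists_col_of_mem φ hjC
    rw [Finset.mem_Icc] at hj hjC
    rcases hcolbox with h | ⟨a, b, hab, hap, hbq, h | h⟩
    · omega
    · have ha1 : 1 ≤ a := hab.1.1.1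
      have hs := rk_add_of_CondB w ha1 (by omega) (by omega) h.1
      exact exists_col_of_factor φ (hbox a b hab) ha1 (by omega) hs hap
        (Finset.Icc_subset_Icc (by omega) hbq) (Finset.mem_Icc.2 (by omega))
    · have hs := hbox a b hab
      rw [rk_eq_zero_of_CondA w h.1] at hs
      refine ⟨0, fun i hi => ?_⟩
      rw [Mmat_mem_of_Iideal_le_ker φ hs (Finset.Icc_subset_Icc_left hap hi)
        (Finset.mem_Icc.2 (by omega))]
      simp
  · by_cases hiP : i ∈ Finset.Icc p (p + r)
    · exact exists_row_of_mem φ hiP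
    rw [Finset.mem_Icc] at hi hiP
    rcases hrowbox with h | ⟨a, b, hab, hpa, hqb, h | h⟩
    · omega
    · have han : a ≤ n := hab.1.1.2.1
      have hbn : b ≤ n := hab.1.1.2.2.2.1
      have hs := rk_add_of_CondB w (by omega) (by omega) hbn h.1
      exact exists_row_of_factor φ (hbox a b hab) (by omega) hbn hs hqb
        (Finset.Icc_subset_Icc hpa (by omega)) (Finset.mem_Icc.2 (by omega))
    · have hs := hbox a b hab
      rw [rk_eq_zero_of_CondA w h.1] at hs
      refine ⟨0, fun j hj => ?_⟩
      rw [Mmat_mem_of_Iideal_le_ker φ hs (Finset.mem_Icc.2 (by omega))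
        (Finset.Icc_subset_Icc_right hqb hj)]
      simp
end

section
/- Let F be a field, let m, n ≥ 2, let R = F[x_{i,j} : 1 ≤ i ≤ m, 1 ≤ j ≤ n], and let I ⊆ R be the ideal generated by all 2×2 minors x_{i,j}x_{i′,j′} − x_{i,j′}x_{i′,j} (for i < i′ and j < j′) of the generic m×n matrix. Then I has height (m−1)(n−1), and every generating set of I has at least (m choose 2)·(n choose 2) elements; in particular, if (m,n) ≠ (2,2), then I cannot be generated by (m−1)(n−1) elements. -/
/-- The height of a prime ideal `P`: the supremum of the lengths of strictly increasing
chains of prime ideals ending at `P` (i.e. of strictly descending chains below `P`). -/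
noncomputable def primeHt {R : Type*} [CommRing R] (P : Ideal R) : ℕ∞ :=
  ⨆ (k : ℕ) (_ : ∃ c : Fin (k + 1) → Ideal R, StrictMono c ∧
    (∀ i, (c i).IsPrime) ∧ c (Fin.last k) = P), (k : ℕ∞)

/-- The height of an ideal `I`: the infimum of the heights of the primes containing it. -/
noncomputable def idealHt {R : Type*} [CommRing R] (I : Ideal R) : ℕ∞ :=
  ⨅ (P : Ideal R) (_ : P.IsPrime) (_ : I ≤ P), primeHt P

section Height

theorem primeHt_eq_height {R : Type*} [CommRing R] (P : Ideal R) [hP : P.IsPrime] :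
    primeHt P = P.height := by
  rw [show P.height = _ from PrimeSpectrum.height_eq_orderHeight ⟨P, hP⟩, Order.height_eq_iSup_last_eq]
  apply le_antisymm
  · refine iSup₂_le fun k ⟨c, hc, hprime, hlast⟩ => ?_
    exact le_iSup₂_of_le (⟨k, fun i => ⟨c i, hprime i⟩, fun i => hc i.castSucc_lt_succ⟩ :
      LTSeries (PrimeSpectrum R)) (PrimeSpectrum.ext hlast) le_rfl
  · refine iSup₂_le fun s hs => ?_
    refine le_iSup₂_of_le s.length ⟨fun i => (s i).asIdeal, fun i j hij => ?_,
      fun i => (s i).isPrime, ?_⟩ le_rfl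
    · exact s.strictMono hij
    · exact congrArg PrimeSpectrum.asIdeal hs

theorem idealHt_eq_height {R : Type*} [CommRing R] (I : Ideal R) : idealHt I = I.height := by
  apply le_antisymm
  · rw [Ideal.height_eq_inf_minimalPrimes]
    refine le_iInf₂ fun P hP => ?_
    have : P.IsPrime := hP.1.1
    exact (iInf₂_le_of_le P this (iInf_le _ hP.1.2)).trans (primeHt_eq_height P).le
  · refine le_iInf₂ fun P hP => le_iInf fun hIP => ?_
    rw [primeHt_eq_height P]
    exact Ideal.height_mono hIP

end Height

namespace MvPolynomial

section Pivot

variable {F ι κ : Type*} [Field F]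

/-- The `2×2` minor of the generic matrix on the rows `a`, `p.1` and the columns `b`, `p.2`. -/
noncomputable def pivotMinor (F : Type*) [Field F] (a : ι) (b : κ) (p : ι × κ) :
    MvPolynomial (ι × κ) F :=
  X (a, b) * X p - X (p.1, b) * X (a, p.2)

/-- The variable `X q` in the fraction field of the polynomial ring. -/
noncomputable abbrev genericEntry (F : Type*) [Field F] (q : ι × κ) :
    FractionRing (MvPolynomial (ι × κ) F) :=
  algebraMap (MvPolynomial (ι × κ) F) _ (X q)

theorem genericEntry_ne_zero (q : ι × κ) : genericEntry F q ≠ 0 := by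
  simp

variable [DecidableEq ι] [DecidableEq κ]

/-- The evaluation at the generic matrix whose entries at the places `p ∈ S` are replaced by
the values making the minors `pivotMinor F a b p` vanish. -/
noncomputable def pivotEval (F : Type*) [Field F] (a : ι) (b : κ) (S : Finset (ι × κ)) :
    MvPolynomial (ι × κ) F →ₐ[F] FractionRing (MvPolynomial (ι × κ) F) :=
  aeval fun p => if p ∈ S then
    genericEntry F (p.1, b) * genericEntry F (a, p.2) / genericEntry F (a, b)
    else genericEntry F p

/-- The kernel of `pivotEval F a b S`. -/
noncomputable def pivotIdeal (F : Type*) [Field F] (a : ι) (b : κ) (S : Finset (ι × κ)) :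
    Ideal (MvPolynomial (ι × κ) F) :=
  RingHom.ker (pivotEval F a b S)

instance (a : ι) (b : κ) (S : Finset (ι × κ)) : (pivotIdeal F a b S).IsPrime :=
  RingHom.ker_isPrime _

variable {a : ι} {b : κ} {S T : Finset (ι × κ)}

theorem pivotEval_X_of_mem {p : ι × κ} (hp : p ∈ S) :
    pivotEval F a b S (X p) =
      genericEntry F (p.1, b) * genericEntry F (a, p.2) / genericEntry F (a, b) := by
  simp [pivotEval, hp]

theorem pivotEval_X_of_notMem {p : ι × κ} (hp : p ∉ S) :
    pivotEval F a b S (X p) = genericEntry F p := by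
  simp [pivotEval, hp]

theorem pivotEval_of_mem_supported {w : MvPolynomial (ι × κ) F}
    (hw : w ∈ supported F ((S : Set (ι × κ))ᶜ)) : pivotEval F a b S w = algebraMap _ _ w := by
  rw [mem_supported] at hw
  refine hom_congr_vars (f₁ := (pivotEval F a b S).toRingHom) (f₂ := algebraMap _ _) ?_ ?_ rfl
  · ext c
    simp only [RingHom.comp_apply]
    rw [← algebraMap_eq, ← IsScalarTower.algebraMap_apply]
    exact (pivotEval F a b S).commutes c
  · intro i hi _
    exact pivotEval_X_of_notMem (hw hi)

theorem X_pivot_notMem (hS : ∀ p ∈ S, p.1 ≠ a ∧ p.2 ≠ b) : X (a, b) ∉ pivotIdeal F a b S := by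
  rw [pivotIdeal, RingHom.mem_ker, pivotEval_X_of_notMem fun h => (hS _ h).1 rfl]
  exact genericEntry_ne_zero _

theorem pivotMinor_mem_pivotIdeal (hS : ∀ p ∈ S, p.1 ≠ a ∧ p.2 ≠ b) {p : ι × κ} (hp : p ∈ S) :
    pivotMinor F a b p ∈ pivotIdeal F a b S := by
  have h1 : ((a, b) : ι × κ) ∉ S := fun h => (hS _ h).1 rfl
  have h2 : ((a, p.2) : ι × κ) ∉ S := fun h => (hS _ h).1 rfl
  have h3 : ((p.1, b) : ι × κ) ∉ S := fun h => (hS _ h).2 rfl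
  rw [pivotIdeal, RingHom.mem_ker, pivotMinor, map_sub, map_mul, map_mul,
    pivotEval_X_of_mem hp, pivotEval_X_of_notMem h1, pivotEval_X_of_notMem h2,
    pivotEval_X_of_notMem h3, mul_div_cancel₀ _ (genericEntry_ne_zero _), sub_self]

theorem pivotMinor_notMem_pivotIdeal (hS : ∀ p ∈ S, p.1 ≠ a ∧ p.2 ≠ b) {p : ι × κ}
    (hp : p ∉ S) (hpa : p.1 ≠ a) (hpb : p.2 ≠ b) : pivotMinor F a b p ∉ pivotIdeal F a b S := by
  have h1 : ((a, b) : ι × κ) ∉ S := fun h => (hS _ h).1 rfl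
  have h2 : ((a, p.2) : ι × κ) ∉ S := fun h => (hS _ h).1 rfl
  have h3 : ((p.1, b) : ι × κ) ∉ S := fun h => (hS _ h).2 rfl
  rw [pivotIdeal, RingHom.mem_ker, pivotMinor, map_sub, map_mul, map_mul,
    pivotEval_X_of_notMem hp, pivotEval_X_of_notMem h1, pivotEval_X_of_notMem h2,
    pivotEval_X_of_notMem h3, ← map_mul, ← map_mul, ← map_sub,
    FaithfulSMul.algebraMap_eq_zero_iff]
  intro h
  -- evaluate at the matrix with entry `1` at the places `(a, b)` and `p`, and `0` elsewhere
  have := congrArg (eval fun q => if q = (a, b) ∨ q = p then (1 : F) else 0) h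
  have h4 : ((a, p.2) : ι × κ) ≠ p := fun h => hpa (congrArg Prod.fst h).symm
  have h5 : ((p.1, b) : ι × κ) ≠ (a, b) := fun h => hpa (congrArg Prod.fst h)
  have h6 : ((p.1, b) : ι × κ) ≠ p := fun h => hpb (congrArg Prod.snd h).symm
  simp [h4, h5, h6] at this

theorem exists_pow_mul_sub_mem_span (hS : ∀ p ∈ S, p.1 ≠ a ∧ p.2 ≠ b)
    (f : MvPolynomial (ι × κ) F) :
    ∃ N : ℕ, ∃ w ∈ supported F ((S : Set (ι × κ))ᶜ),
      X (a, b) ^ N * f - w ∈ Ideal.span (pivotMinor F a b '' S) := by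
  have hX : ∀ q ∉ S, (X q : MvPolynomial (ι × κ) F) ∈ supported F ((S : Set (ι × κ))ᶜ) :=
    fun q hq => X_mem_supported.2 hq
  have h1 : ((a, b) : ι × κ) ∉ S := fun h => (hS _ h).1 rfl
  induction f using MvPolynomial.induction_on with
  | C c => exact ⟨0, C c, Subalgebra.algebraMap_mem _ c, by simp⟩
  | add f g hf hg =>
    obtain ⟨N, w, hw, hfw⟩ := hf
    obtain ⟨M, v, hv, hgv⟩ := hg
    refine ⟨N + M, X (a, b) ^ M * w + X (a, b) ^ N * v,
      add_mem (mul_mem (pow_mem (hX _ h1) _) hw) (mul_mem (pow_mem (hX _ h1) _) hv), ?_⟩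
    convert! add_mem (Ideal.mul_mem_left _ (X (a, b) ^ M) hfw)
      (Ideal.mul_mem_left _ (X (a, b) ^ N) hgv) using 1
    ring
  | mul_X f p hf =>
    obtain ⟨N, w, hw, hfw⟩ := hf
    by_cases hp : p ∈ S
    · refine ⟨N + 1, w * (X (p.1, b) * X (a, p.2)), mul_mem hw (mul_mem
        (hX _ fun h => (hS _ h).2 rfl) (hX _ fun h => (hS _ h).1 rfl)), ?_⟩
      convert! add_mem (Ideal.mul_mem_left _ (X (a, b) * X p) hfw) (Ideal.mul_mem_left _ w
        (Ideal.subset_span (Set.mem_image_of_mem (pivotMinor F a b) hp))) using 1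
      rw [pivotMinor]
      ring
    · refine ⟨N, w * X p, mul_mem hw (hX _ hp), ?_⟩
      convert! Ideal.mul_mem_left _ (X p) hfw using 1
      ring

/-- `pivotIdeal F a b S` is the least prime containing the minors `pivotMinor F a b p`, `p ∈ S`,
but not the pivot `X (a, b)`. -/
theorem pivotIdeal_le (hS : ∀ p ∈ S, p.1 ≠ a ∧ p.2 ≠ b) {Q : Ideal (MvPolynomial (ι × κ) F)}
    [hQ : Q.IsPrime] (hQS : ∀ p ∈ S, pivotMinor F a b p ∈ Q) (hQX : X (a, b) ∉ Q) :
    pivotIdeal F a b S ≤ Q := by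
  intro f hf
  obtain ⟨N, w, hw, hfw⟩ := exists_pow_mul_sub_mem_span hS f
  have hle : ∀ {P : Ideal (MvPolynomial (ι × κ) F)}, (∀ p ∈ S, pivotMinor F a b p ∈ P) →
      Ideal.span (pivotMinor F a b '' S) ≤ P := fun h => by
    rw [Ideal.span_le]
    rintro _ ⟨p, hp, rfl⟩
    exact h p hp
  have hw0 : w ∈ pivotIdeal F a b S := by
    have h := sub_mem (Ideal.mul_mem_left _ (X (a, b) ^ N) hf)
      (hle (fun p hp => pivotMinor_mem_pivotIdeal hS hp) hfw)
    rwa [sub_sub_cancel] at h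
  rw [pivotIdeal, RingHom.mem_ker, pivotEval_of_mem_supported hw,
    FaithfulSMul.algebraMap_eq_zero_iff] at hw0
  rw [hw0, sub_zero] at hfw
  exact (hQ.mem_or_mem (hle hQS hfw)).resolve_left fun h => hQX (hQ.mem_of_pow_mem _ h)

theorem card_le_height_pivotIdeal (hS : ∀ p ∈ S, p.1 ≠ a ∧ p.2 ≠ b) :
    (S.card : ℕ∞) ≤ (pivotIdeal F a b S).height := by
  induction S using Finset.induction_on with
  | empty => simp
  | insert p S hp ih =>
    have hS' : ∀ q ∈ S, q.1 ≠ a ∧ q.2 ≠ b := fun q hq => hS q (Finset.mem_insert_of_mem hq)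
    have hlt : pivotIdeal F a b S < pivotIdeal F a b (insert p S) := by
      refine lt_of_le_of_ne (pivotIdeal_le hS' (fun q hq => pivotMinor_mem_pivotIdeal hS
        (Finset.mem_insert_of_mem hq)) (X_pivot_notMem hS)) fun h => ?_
      refine pivotMinor_notMem_pivotIdeal hS' hp (hS p (Finset.mem_insert_self _ _)).1
        (hS p (Finset.mem_insert_self _ _)).2 (F := F) ?_
      rw [h]
      exact pivotMinor_mem_pivotIdeal hS (Finset.mem_insert_self _ _)
    rw [Finset.card_insert_of_notMem hp]
    push_cast
    exact (add_le_add_left (ih hS') 1).trans (Ideal.height_add_one_le_of_lt_of_isPrime hlt)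

theorem height_pivotIdeal_le [Finite ι] [Finite κ] (hS : ∀ p ∈ S, p.1 ≠ a ∧ p.2 ≠ b) :
    (pivotIdeal F a b S).height ≤ S.card := by
  have hmin : pivotIdeal F a b S ∈ (Ideal.span (pivotMinor F a b '' S)).minimalPrimes := by
    refine ⟨⟨inferInstance, ?_⟩, fun Q hQ hle => ?_⟩
    · rw [Ideal.span_le]
      rintro _ ⟨p, hp, rfl⟩
      exact pivotMinor_mem_pivotIdeal hS hp
    · have := hQ.1
      exact pivotIdeal_le hS
        (fun p hp => hQ.2 (Ideal.subset_span (Set.mem_image_of_mem _ hp)))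
        (fun h => X_pivot_notMem hS (hle h))
  refine (Ideal.height_le_card_of_mem_minimalPrimes_span (S.finite_toSet.image _) hmin).trans ?_
  exact_mod_cast (Set.ncard_image_le S.finite_toSet).trans (Set.ncard_coe_finset S).le

theorem pivotIdeal_le_of_forall_X_mem (hS : ∀ p ∈ S, p.1 ≠ a ∧ p.2 ≠ b)
    {P : Ideal (MvPolynomial (ι × κ) F)} (hP : ∀ p, X p ∈ P) : pivotIdeal F a b S ≤ P := by
  let e : MvPolynomial (ι × κ) F →ₐ[F] Polynomial F :=
    aeval fun q => if q = (a, b) then Polynomial.X else 0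
  have he : RingHom.ker e ≤ idealOfVars (ι × κ) F := by
    intro f hf
    have h0 : constantCoeff f = 0 := by
      have h : constantCoeff = (Polynomial.constantCoeff.comp e.toRingHom : _ →+* F) := by
        apply ringHom_ext
        · intro r; simp [e]
        · intro q
          by_cases hq : q = (a, b) <;> simp [e, hq]
      rw [h]
      simp [show e f = 0 from hf]
    rw [← pow_one (idealOfVars (ι × κ) F), mem_pow_idealOfVars_iff']
    intro x hx
    rw [Nat.lt_one_iff, Finsupp.degree_eq_zero_iff] at hx
    rwa [hx, ← constantCoeff_eq]
  have hprime : (RingHom.ker e).IsPrime := RingHom.ker_isPrime _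
  refine (pivotIdeal_le hS (Q := RingHom.ker e) (fun p hp => ?_) ?_).trans (he.trans ?_)
  · have h1 : p ≠ (a, b) := fun h => (hS p hp).1 (by rw [h])
    simp [RingHom.mem_ker, pivotMinor, e, h1, (hS p hp).1]
  · simp [RingHom.mem_ker, e]
  · rw [idealOfVars, Ideal.span_le]
    rintro _ ⟨p, rfl⟩
    exact hP p

end Pivot

section Generators

variable {F σ : Type*} [Field F]

theorem coeff_mul_of_mem_pow_idealOfVars {n : ℕ} {g : MvPolynomial σ F}
    (hg : g ∈ idealOfVars σ F ^ n) (r : MvPolynomial σ F) {d : σ →₀ ℕ} (hd : d.degree = n) :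
    coeff d (r * g) = constantCoeff r * coeff d g := by
  classical
  rw [mem_pow_idealOfVars_iff'] at hg
  rw [coeff_mul, Finset.sum_eq_single (0, d), constantCoeff_eq]
  · rintro ⟨u, v⟩ huv hne
    rw [Finset.HasAntidiagonal.mem_antidiagonal] at huv
    have hu : u ≠ 0 := by
      rintro rfl
      exact hne (by rw [← huv, zero_add])
    have h := congrArg Finsupp.degree huv
    rw [map_add, hd] at h
    have h0 : u.degree ≠ 0 := by rwa [Ne, Finsupp.degree_eq_zero_iff]
    rw [hg v (by simp only at h; omega), mul_zero]
  · simp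

/-- If an ideal `J` has no elements of order less than `n` and contains a family dual to a family
of monomials of degree `n`, then every generating set of `J` is at least as large as the family. -/
theorem card_le_of_span_range_eq {ι : Type*} [Fintype ι] [DecidableEq ι] {n k : ℕ}
    {J : Ideal (MvPolynomial σ F)} (hJ : J ≤ idealOfVars σ F ^ n) (d : ι → σ →₀ ℕ)
    (hd : ∀ i, (d i).degree = n) (f : ι → MvPolynomial σ F) (hf : ∀ i, f i ∈ J)
    (hdf : ∀ i j, coeff (d j) (f i) = if i = j then 1 else 0)
    (g : Fin k → MvPolynomial σ F) (hg : Ideal.span (Set.range g) = J) :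
    Fintype.card ι ≤ k := by
  let L : MvPolynomial σ F →ₗ[F] (ι → F) := LinearMap.pi fun i => lcoeff F (d i)
  have hL : ∀ h ∈ J, L h ∈ Submodule.span F (Set.range fun l => L (g l)) := by
    intro h hh
    rw [← hg] at hh
    obtain ⟨c, rfl⟩ := Ideal.mem_span_range_iff_exists_fun.1 hh
    rw [map_sum]
    refine sum_mem fun l _ => ?_
    have hl : L (c l * g l) = constantCoeff (c l) • L (g l) := by
      ext i
      exact coeff_mul_of_mem_pow_idealOfVars
        (hJ (hg ▸ Ideal.subset_span (Set.mem_range_self l))) _ (hd i)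
    rw [hl]
    exact Submodule.smul_mem _ _ (Submodule.subset_span ⟨l, rfl⟩)
  have htop : Submodule.span F (Set.range fun l => L (g l)) = ⊤ := by
    rw [eq_top_iff, ← (Pi.basisFun F ι).span_eq, Submodule.span_le]
    rintro _ ⟨i, rfl⟩
    convert! hL (f i) (hf i) using 1
    ext j
    simp [L, hdf, Pi.single_apply, eq_comm]
  have h := finrank_range_le_card (R := F) fun l => L (g l)
  rwa [Set.finrank, htop, finrank_top, Module.finrank_fintype_fun_eq_card, Fintype.card_fin] at h

end Generators

section GenericMatrix

variable (F : Type*) [Field F] (m n : ℕ)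

/-- The ideal of `2×2` minors of the generic `m×n` matrix. -/
noncomputable def minorsIdeal : Ideal (MvPolynomial (Fin m × Fin n) F) :=
  Ideal.span {f | ∃ (i i' : Fin m) (j j' : Fin n), i < i' ∧ j < j' ∧
    f = X (i, j) * X (i', j') - X (i, j') * X (i', j)}

variable {F m n}

theorem minor_mem_minorsIdeal (i i' : Fin m) (j j' : Fin n) :
    (X (i, j) * X (i', j') - X (i, j') * X (i', j) : MvPolynomial (Fin m × Fin n) F) ∈
      minorsIdeal F m n := by
  have key : ∀ (i i' : Fin m) (j j' : Fin n), i < i' →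
      (X (i, j) * X (i', j') - X (i, j') * X (i', j) : MvPolynomial (Fin m × Fin n) F) ∈
        minorsIdeal F m n := by
    intro i i' j j' hi
    rcases lt_trichotomy j j' with hj | rfl | hj
    · exact Ideal.subset_span ⟨i, i', j, j', hi, hj, rfl⟩
    · simp
    · rw [← neg_sub]
      exact neg_mem (Ideal.subset_span ⟨i, i', j', j, hi, hj, rfl⟩)
  rcases lt_trichotomy i i' with hi | rfl | hi
  · exact key i i' j j' hi
  · rw [mul_comm, sub_self]
    exact zero_mem _
  · convert! key i' i j' j hi using 1
    ring

theorem pivotMinor_mem_minorsIdeal (a : Fin m) (b : Fin n) (p : Fin m × Fin n) :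
    pivotMinor F a b p ∈ minorsIdeal F m n := by
  rw [pivotMinor, mul_comm (X (p.1, b))]
  exact minor_mem_minorsIdeal a p.1 b p.2

/-- The places outside of the row `a` and the column `b`. -/
def pivotComplement (a : Fin m) (b : Fin n) : Finset (Fin m × Fin n) :=
  Finset.univ.erase a ×ˢ Finset.univ.erase b

theorem mem_pivotComplement {a : Fin m} {b : Fin n} {p : Fin m × Fin n} :
    p ∈ pivotComplement a b ↔ p.1 ≠ a ∧ p.2 ≠ b := by
  simp [pivotComplement]

theorem card_pivotComplement (a : Fin m) (b : Fin n) :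
    (pivotComplement a b).card = (m - 1) * (n - 1) := by
  simp [pivotComplement]

theorem pivotEval_pivotComplement_X (a : Fin m) (b : Fin n) (p : Fin m × Fin n) :
    pivotEval F a b (pivotComplement a b) (X p) =
      genericEntry F (p.1, b) * genericEntry F (a, p.2) / genericEntry F (a, b) := by
  by_cases hp : p ∈ pivotComplement a b
  · exact pivotEval_X_of_mem hp
  · rw [pivotEval_X_of_notMem hp, eq_div_iff (genericEntry_ne_zero _)]
    obtain ⟨i, j⟩ := p
    rw [mem_pivotComplement, not_and_or, not_not, not_not] at hp
    rcases hp with rfl | rfl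
    · exact mul_comm _ _
    · rfl

theorem minorsIdeal_le_pivotIdeal (a : Fin m) (b : Fin n) :
    minorsIdeal F m n ≤ pivotIdeal F a b (pivotComplement a b) := by
  rw [minorsIdeal, Ideal.span_le]
  rintro _ ⟨i, i', j, j', -, -, rfl⟩
  rw [SetLike.mem_coe, pivotIdeal, RingHom.mem_ker]
  simp only [map_sub, map_mul, pivotEval_pivotComplement_X]
  ring

theorem height_minorsIdeal (hm : 0 < m) (hn : 0 < n) :
    (minorsIdeal F m n).height = ((m - 1) * (n - 1) : ℕ) := by
  have hS : ∀ (a : Fin m) (b : Fin n), ∀ p ∈ pivotComplement a b, p.1 ≠ a ∧ p.2 ≠ b :=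
    fun a b p hp => mem_pivotComplement.1 hp
  apply le_antisymm
  · let a : Fin m := ⟨0, hm⟩
    let b : Fin n := ⟨0, hn⟩
    rw [← card_pivotComplement a b]
    exact (Ideal.height_mono (minorsIdeal_le_pivotIdeal a b)).trans (height_pivotIdeal_le (hS a b))
  · rw [Ideal.height_eq_inf_minimalPrimes]
    refine le_iInf₂ fun P hP => ?_
    have hprime : P.IsPrime := hP.1.1
    obtain ⟨a, b, hab⟩ : ∃ a b, pivotIdeal F a b (pivotComplement a b) ≤ P := by
      by_cases h : ∀ p, X p ∈ P
      · exact ⟨⟨0, hm⟩, ⟨0, hn⟩, pivotIdeal_le_of_forall_X_mem (hS _ _) h⟩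
      · obtain ⟨⟨a, b⟩, hab⟩ := not_forall.1 h
        exact ⟨a, b, pivotIdeal_le (hS a b)
          (fun p _ => hP.1.2 (pivotMinor_mem_minorsIdeal a b p)) hab⟩
    rw [← card_pivotComplement a b]
    exact (card_le_height_pivotIdeal (hS a b)).trans (Ideal.height_mono hab)

theorem minorsIdeal_le_sq_idealOfVars :
    minorsIdeal F m n ≤ idealOfVars (Fin m × Fin n) F ^ 2 := by
  have hX : ∀ p, (X p : MvPolynomial (Fin m × Fin n) F) ∈ idealOfVars (Fin m × Fin n) F :=
    fun p => Ideal.subset_span ⟨p, rfl⟩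
  rw [minorsIdeal, Ideal.span_le, sq]
  rintro _ ⟨i, i', j, j', -, -, rfl⟩
  exact sub_mem (Ideal.mul_mem_mul (hX _) (hX _)) (Ideal.mul_mem_mul (hX _) (hX _))

theorem card_lt_pairs (m : ℕ) :
    Fintype.card {p : Fin m × Fin m // p.1 < p.2} = m.choose 2 := by
  rw [Fintype.card_subtype, Finset.card_filter, Fintype.sum_prod_type_right]
  simp only [← Finset.card_filter]
  have h : ∀ i : Fin m, (Finset.univ.filter (· < i)).card = (i : ℕ) := fun i => by
    rw [Finset.filter_gt_eq_Iio, Fin.card_Iio]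
  simp only [h]
  rw [Fin.sum_univ_eq_sum_range (fun i => i), Finset.sum_range_id, Nat.choose_two_right]

theorem single_add_single_inj {i i' k k' : Fin m} {j j' l l' : Fin n} (hi : i < i') (hk : k < k')
    (h : (Finsupp.single (i, j) 1 + Finsupp.single (i', j') 1 : Fin m × Fin n →₀ ℕ) =
      Finsupp.single (k, l) 1 + Finsupp.single (k', l') 1) :
    i = k ∧ i' = k' ∧ j = l ∧ j' = l' := by
  have h1 := DFunLike.congr_fun h (i, j)
  have h2 := DFunLike.congr_fun h (i', j')
  simp only [Finsupp.add_apply, Finsupp.single_apply, Prod.mk.injEq] at h1 h2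
  grind

theorem choose_mul_choose_le_of_span_range_eq {k : ℕ} (g : Fin k → MvPolynomial (Fin m × Fin n) F)
    (hg : Ideal.span (Set.range g) = minorsIdeal F m n) : m.choose 2 * n.choose 2 ≤ k := by
  rw [← card_lt_pairs m, ← card_lt_pairs n, ← Fintype.card_prod]
  refine card_le_of_span_range_eq minorsIdeal_le_sq_idealOfVars
    (fun q => Finsupp.single (q.1.1.1, q.2.1.1) 1 + Finsupp.single (q.1.1.2, q.2.1.2) 1)
    (fun q => by simp)
    (fun q => X (q.1.1.1, q.2.1.1) * X (q.1.1.2, q.2.1.2) -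
      X (q.1.1.1, q.2.1.2) * X (q.1.1.2, q.2.1.1))
    (fun q => minor_mem_minorsIdeal _ _ _ _) ?_ g hg
  rintro ⟨⟨⟨i, i'⟩, hi⟩, ⟨⟨j, j'⟩, hj⟩⟩ ⟨⟨⟨k, k'⟩, hk⟩, ⟨⟨l, l'⟩, hl⟩⟩
  simp only at hi hj hk hl
  have hanti : (Finsupp.single (i, j') 1 + Finsupp.single (i', j) 1 : Fin m × Fin n →₀ ℕ) ≠
      Finsupp.single (k, l) 1 + Finsupp.single (k', l') 1 := fun h => by
    obtain ⟨rfl, rfl, rfl, rfl⟩ := single_add_single_inj hi hk h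
    exact lt_asymm hj hl
  simp only [X, monomial_mul, coeff_sub, coeff_monomial, if_neg hanti, mul_one, sub_zero]
  refine if_congr ⟨fun h => ?_, fun h => ?_⟩ rfl rfl
  · obtain ⟨rfl, rfl, rfl, rfl⟩ := single_add_single_inj hi hk h
    rfl
  · cases h
    rfl

end GenericMatrix

end MvPolynomial

theorem sub_one_mul_sub_one_lt_choose_mul_choose {m n : ℕ} (hm : 2 ≤ m) (hn : 2 ≤ n)
    (hmn : (m, n) ≠ (2, 2)) : (m - 1) * (n - 1) < m.choose 2 * n.choose 2 := by
  obtain ⟨m, rfl⟩ := Nat.exists_eq_add_of_le' hm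
  obtain ⟨n, rfl⟩ := Nat.exists_eq_add_of_le' hn
  have h : ∀ k : ℕ, 2 * (k + 2).choose 2 = (k + 2) * (k + 1) := fun k => by
    rw [Nat.choose_two_right,
      Nat.mul_div_cancel' (Nat.even_mul_pred_self (k + 2)).two_dvd]
    rfl
  have h4 : 0 < m + n := by
    by_contra h0
    obtain ⟨rfl, rfl⟩ : m = 0 ∧ n = 0 := by omega
    exact hmn rfl
  have hm' := h m
  have hn' := h n
  simp only [Nat.add_sub_assoc one_le_two]
  norm_num
  have : (2 * (m + 2).choose 2) * (2 * (n + 2).choose 2) =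
      (m + 2) * (m + 1) * ((n + 2) * (n + 1)) := by rw [hm', hn']
  have h5 : 4 < (m + 2) * (n + 2) := by nlinarith
  have h6 : 0 < (m + 1) * (n + 1) := by positivity
  nlinarith

open MvPolynomial in
/-- The ideal of `2×2` minors of the generic `m×n` matrix (`m, n ≥ 2`) has height
`(m−1)(n−1)`, every generating set has at least `C(m,2)·C(n,2)` elements, and in
particular for `(m,n) ≠ (2,2)` it cannot be generated by `(m−1)(n−1)` elements. -/
theorem generic_matrix_minors_not_lci (F : Type*) [Field F] (m n : ℕ)
    (hm : 2 ≤ m) (hn : 2 ≤ n)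
    (I : Ideal (MvPolynomial (Fin m × Fin n) F))
    (hI : I = Ideal.span {f | ∃ (i i' : Fin m) (j j' : Fin n), i < i' ∧ j < j' ∧
      f = X (i, j) * X (i', j') - X (i, j') * X (i', j)}) :
    idealHt I = (((m - 1) * (n - 1) : ℕ) : ℕ∞) ∧
      (∀ (k : ℕ) (g : Fin k → MvPolynomial (Fin m × Fin n) F),
        Ideal.span (Set.range g) = I → m.choose 2 * n.choose 2 ≤ k) ∧
      ((m, n) ≠ (2, 2) →
        ∀ g : Fin ((m - 1) * (n - 1)) → MvPolynomial (Fin m × Fin n) F,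
          Ideal.span (Set.range g) ≠ I) := by
  replace hI : I = minorsIdeal F m n := hI
  subst hI
  have hgen : ∀ (k : ℕ) (g : Fin k → MvPolynomial (Fin m × Fin n) F),
      Ideal.span (Set.range g) = minorsIdeal F m n → m.choose 2 * n.choose 2 ≤ k :=
    fun _ => choose_mul_choose_le_of_span_range_eq
  refine ⟨?_, hgen, fun hmn g hg => ?_⟩
  · rw [idealHt_eq_height, height_minorsIdeal (by omega) (by omega)]
  · exact (hgen _ g hg).not_gt (sub_one_mul_sub_one_lt_choose_mul_choose hm hn hmn)
end

section
/- Let F be a field and R = F[a,b,c,d,e,f,g,h]. Then the ideal I = (ad−bc, ag−bf, cg−df, ch−ef, dh−eg) has height 3, and every generating set of I has at least 5 elements. -/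
theorem Ideal.three_le_height_of_lt_of_lt {R : Type*} [CommRing R] [IsDomain R]
    {A B C P : Ideal R} [A.IsPrime] [B.IsPrime] [C.IsPrime]
    (hA : ⊥ < A) (hB : A < B) (hC : B < C) (hP : C ≤ P) : 3 ≤ P.height := by
  have h₁ := Ideal.height_add_one_le_of_lt_of_isPrime hA
  have h₂ := Ideal.height_add_one_le_of_lt_of_isPrime hB
  have h₃ := Ideal.height_add_one_le_of_lt_of_isPrime hC
  rw [Ideal.height_bot] at h₁
  calc (3 : ℕ∞) = 0 + 1 + 1 + 1 := by norm_num
    _ ≤ A.height + 1 + 1 := by gcongr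
    _ ≤ B.height + 1 := by gcongr
    _ ≤ C.height := h₃
    _ ≤ P.height := Ideal.height_mono hP

namespace CornerMatrix

open MvPolynomial

variable {F : Type*} [Field F]

/-- The ideal of `2 × 2` minors of the array `(a, b, —), (c, d, e), (f, g, h)`. -/
noncomputable def minorIdeal (F : Type*) [Field F] : Ideal (MvPolynomial (Fin 8) F) :=
  Ideal.span {X 0 * X 3 - X 1 * X 2, X 0 * X 6 - X 1 * X 5, X 2 * X 6 - X 3 * X 5,
    X 2 * X 7 - X 4 * X 5, X 3 * X 7 - X 4 * X 6}

theorem minorIdeal_le_iff {Q : Ideal (MvPolynomial (Fin 8) F)} :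
    minorIdeal F ≤ Q ↔ X 0 * X 3 - X 1 * X 2 ∈ Q ∧ X 0 * X 6 - X 1 * X 5 ∈ Q ∧
      X 2 * X 6 - X 3 * X 5 ∈ Q ∧ X 2 * X 7 - X 4 * X 5 ∈ Q ∧ X 3 * X 7 - X 4 * X 6 ∈ Q := by
  simp [minorIdeal, Ideal.span_le, Set.insert_subset_iff]

theorem ker_aeval_le_of_forall_sub_mem {Q : Ideal (MvPolynomial (Fin 8) F)}
    {v : Fin 8 → MvPolynomial (Fin 8) F} (hv : ∀ i, X i - v i ∈ Q) :
    RingHom.ker (aeval (R := F) v) ≤ Q := by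
  have h : (Ideal.Quotient.mkₐ F Q).comp (aeval v) = Ideal.Quotient.mkₐ F Q := by
    ext i
    simpa using (Ideal.Quotient.eq.mpr (hv i)).symm
  intro p hp
  rw [RingHom.mem_ker] at hp
  have := DFunLike.congr_fun h p
  simp only [AlgHom.comp_apply, hp, map_zero] at this
  exact Ideal.Quotient.eq_zero_iff_mem.mp this.symm

/-- Parametrization of the locus where the minor on `a, b, c, d` vanishes and `d ≠ 0`. -/
noncomputable def param₁ (F : Type*) [Field F] :
    MvPolynomial (Fin 8) F →ₐ[F] MvPolynomial (Fin 8) F :=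
  aeval ![X 1 * X 2, X 1 * X 3, X 2, X 3, X 4, X 5, X 6, X 7]

/-- Parametrization of the locus where moreover the minor on `c, d, f, g` vanishes. -/
noncomputable def param₂ (F : Type*) [Field F] :
    MvPolynomial (Fin 8) F →ₐ[F] MvPolynomial (Fin 8) F :=
  aeval ![X 1 * X 2, X 1 * X 3, X 2, X 3, X 4, X 2 * X 6, X 3 * X 6, X 7]

/-- Parametrization of the locus where all minors vanish and `d ≠ 0`. -/
noncomputable def param₃ (F : Type*) [Field F] :
    MvPolynomial (Fin 8) F →ₐ[F] MvPolynomial (Fin 8) F :=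
  aeval ![X 1 * X 2, X 1 * X 3, X 2, X 3, X 4, X 2 * X 6, X 3 * X 6, X 4 * X 6]

theorem ker_param₁_le_ker_param₂ : RingHom.ker (param₁ F) ≤ RingHom.ker (param₂ F) := by
  have h : param₂ F = (aeval ![X 0, X 1, X 2, X 3, X 4, X 2 * X 6, X 3 * X 6, X 7]).comp
      (param₁ F) := by
    ext i : 1
    fin_cases i <;> simp [param₁, param₂]
  intro p hp
  rw [RingHom.mem_ker] at hp ⊢
  simp [h, hp]

theorem ker_param₂_le_ker_param₃ : RingHom.ker (param₂ F) ≤ RingHom.ker (param₃ F) := by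
  have h : param₃ F = (aeval ![X 0, X 1, X 2, X 3, X 4, X 5, X 6, X 4 * X 6]).comp
      (param₂ F) := by
    ext i : 1
    fin_cases i <;> simp [param₂, param₃]
  intro p hp
  rw [RingHom.mem_ker] at hp ⊢
  simp [h, hp]

theorem minorIdeal_le_ker_param₃ : minorIdeal F ≤ RingHom.ker (param₃ F) := by
  rw [minorIdeal_le_iff]
  refine ⟨?_, ?_, ?_, ?_, ?_⟩ <;> rw [RingHom.mem_ker] <;> simp [param₃] <;> ring

theorem ker_param₃_le_ker {K : Type*} [Field K] [Algebra F K] (π : MvPolynomial (Fin 8) F →ₐ[F] K)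
    (h₁ : π (X 0 * X 3 - X 1 * X 2) = 0) (h₂ : π (X 2 * X 6 - X 3 * X 5) = 0)
    (h₃ : π (X 3 * X 7 - X 4 * X 6) = 0) (hd : π (X 3) ≠ 0) :
    RingHom.ker (param₃ F) ≤ RingHom.ker π := by
  simp only [map_sub, map_mul] at h₁ h₂ h₃
  have h : (aeval ![0, π (X 1) / π (X 3), π (X 2), π (X 3), π (X 4), 0, π (X 6) / π (X 3), 0]).comp
      (param₃ F) = π := by
    ext i : 1
    fin_cases i <;> simp [param₃] <;> field_simp <;> grind
  intro p hp
  rw [RingHom.mem_ker] at hp ⊢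
  rw [← h]
  simp [hp]

theorem ker_param₃_le {Q : Ideal (MvPolynomial (Fin 8) F)} [Q.IsPrime]
    (h₁ : X 0 * X 3 - X 1 * X 2 ∈ Q) (h₂ : X 2 * X 6 - X 3 * X 5 ∈ Q)
    (h₃ : X 3 * X 7 - X 4 * X 6 ∈ Q) (hd : X 3 ∉ Q) :
    RingHom.ker (param₃ F) ≤ Q := by
  let K := FractionRing (MvPolynomial (Fin 8) F ⧸ Q)
  let π : MvPolynomial (Fin 8) F →ₐ[F] K :=
    (IsScalarTower.toAlgHom F (MvPolynomial (Fin 8) F ⧸ Q) K).comp (Ideal.Quotient.mkₐ F Q)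
  have hπ (p) : π p = 0 ↔ p ∈ Q := by
    rw [← Ideal.Quotient.eq_zero_iff_mem]
    exact FaithfulSMul.algebraMap_eq_zero_iff (MvPolynomial (Fin 8) F ⧸ Q) K
  intro p hp
  rw [← hπ] at h₁ h₂ h₃ hd ⊢
  exact RingHom.mem_ker.mp (ker_param₃_le_ker π h₁ h₂ h₃ hd hp)

theorem three_le_height_of_X_three_notMem {P : Ideal (MvPolynomial (Fin 8) F)} [P.IsPrime]
    (hP : minorIdeal F ≤ P) (hd : X 3 ∉ P) : 3 ≤ P.height := by
  obtain ⟨h₁, -, h₂, -, h₃⟩ := minorIdeal_le_iff.mp hP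
  have := RingHom.ker_isPrime (param₁ F)
  have := RingHom.ker_isPrime (param₂ F)
  have := RingHom.ker_isPrime (param₃ F)
  refine Ideal.three_le_height_of_lt_of_lt (A := RingHom.ker (param₁ F))
    (B := RingHom.ker (param₂ F)) (C := RingHom.ker (param₃ F)) ?_ ?_ ?_
    (ker_param₃_le h₁ h₂ h₃ hd)
  · refine SetLike.lt_iff_le_and_exists.mpr ⟨bot_le, X 0 * X 3 - X 1 * X 2, ?_, ?_⟩
    · rw [RingHom.mem_ker]
      simp [param₁]
      ring
    · intro h
      simpa using congrArg (eval ![1, 0, 0, 1, 0, 0, 0, 0]) ((Submodule.mem_bot _).mp h)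
  · refine SetLike.lt_iff_le_and_exists.mpr
      ⟨ker_param₁_le_ker_param₂, X 2 * X 6 - X 3 * X 5, ?_, ?_⟩
    · rw [RingHom.mem_ker]
      simp [param₂]
      ring
    · intro h
      simpa [param₁] using congrArg (eval ![0, 0, 1, 0, 0, 0, 1, 0]) (RingHom.mem_ker.mp h)
  · refine SetLike.lt_iff_le_and_exists.mpr
      ⟨ker_param₂_le_ker_param₃, X 3 * X 7 - X 4 * X 6, ?_, ?_⟩
    · rw [RingHom.mem_ker]
      simp [param₃]
      ring
    · intro h
      simpa [param₂] using congrArg (eval ![0, 0, 0, 1, 0, 0, 0, 1]) (RingHom.mem_ker.mp h)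

theorem three_le_height_of_X_notMem {P : Ideal (MvPolynomial (Fin 8) F)} [P.IsPrime]
    (e : Equiv.Perm (Fin 8)) (he : minorIdeal F ≤ P.comap (renameEquiv F e).toRingEquiv)
    (hd : X (e 3) ∉ P) : 3 ≤ P.height := by
  rw [← RingEquiv.height_comap (renameEquiv F e).toRingEquiv P]
  refine three_le_height_of_X_three_notMem he ?_
  simpa [Ideal.mem_comap] using hd

theorem three_le_height_of_X_mem {P : Ideal (MvPolynomial (Fin 8) F)}
    (h₂ : X 2 ∈ P) (h₃ : X 3 ∈ P) (h₅ : X 5 ∈ P) : 3 ≤ P.height := by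
  let φ₁ : MvPolynomial (Fin 8) F →ₐ[F] MvPolynomial (Fin 8) F :=
    aeval ![X 0, X 1, 0, X 3, X 4, X 5, X 6, X 7]
  let φ₂ : MvPolynomial (Fin 8) F →ₐ[F] MvPolynomial (Fin 8) F :=
    aeval ![X 0, X 1, 0, 0, X 4, X 5, X 6, X 7]
  let φ₃ : MvPolynomial (Fin 8) F →ₐ[F] MvPolynomial (Fin 8) F :=
    aeval ![X 0, X 1, 0, 0, X 4, 0, X 6, X 7]
  have := RingHom.ker_isPrime φ₁
  have := RingHom.ker_isPrime φ₂
  have := RingHom.ker_isPrime φ₃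
  refine Ideal.three_le_height_of_lt_of_lt (A := RingHom.ker φ₁)
    (B := RingHom.ker φ₂) (C := RingHom.ker φ₃) ?_ ?_ ?_ ?_
  · refine SetLike.lt_iff_le_and_exists.mpr ⟨bot_le, X 2, ?_, ?_⟩
    · simp [RingHom.mem_ker, φ₁]
    · simp
  · refine SetLike.lt_iff_le_and_exists.mpr ⟨ker_aeval_le_of_forall_sub_mem ?_, X 3, ?_, ?_⟩
    · intro i
      fin_cases i <;> simp [RingHom.mem_ker, φ₂]
    · simp [RingHom.mem_ker, φ₂]
    · simp [RingHom.mem_ker, φ₁]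
  · refine SetLike.lt_iff_le_and_exists.mpr ⟨ker_aeval_le_of_forall_sub_mem ?_, X 5, ?_, ?_⟩
    · intro i
      fin_cases i <;> simp [RingHom.mem_ker, φ₃]
    · simp [RingHom.mem_ker, φ₃]
    · simp [RingHom.mem_ker, φ₂]
  · refine ker_aeval_le_of_forall_sub_mem ?_
    intro i
    fin_cases i <;> simp [h₂, h₃, h₅]

theorem three_le_height {P : Ideal (MvPolynomial (Fin 8) F)} [P.IsPrime]
    (hP : minorIdeal F ≤ P) : 3 ≤ P.height := by
  obtain ⟨h₁, h₂, h₃, h₄, h₅⟩ := minorIdeal_le_iff.mp hP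
  have neg {p q : MvPolynomial (Fin 8) F} (h : p - q ∈ P) : q - p ∈ P := by
    simpa using P.neg_mem h
  by_cases hd : X 3 ∈ P
  swap
  · exact three_le_height_of_X_three_notMem hP hd
  by_cases hc : X 2 ∈ P
  swap
  · refine three_le_height_of_X_notMem
      (Equiv.swap 0 1 * Equiv.swap 2 3 * Equiv.swap 5 6) ?_ ?_
    · rw [minorIdeal_le_iff]
      simp [Ideal.mem_comap, Equiv.swap_apply_def]
      exact ⟨neg h₁, neg h₂, neg h₃, h₅, h₄⟩
    · simpa [Equiv.swap_apply_def] using hc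
  by_cases hf : X 5 ∈ P
  swap
  · refine three_le_height_of_X_notMem
      (Equiv.swap 0 1 * Equiv.swap 2 6 * Equiv.swap 3 5 * Equiv.swap 4 7) ?_ ?_
    · rw [minorIdeal_le_iff]
      simp [Ideal.mem_comap, Equiv.swap_apply_def]
      refine ⟨neg h₂, neg h₁, ?_, ?_, ?_⟩
      · convert h₃ using 1
        ring
      · convert neg h₅ using 1
        ring
      · convert neg h₄ using 1
        ring
    · simpa [Equiv.swap_apply_def] using hf
  exact three_le_height_of_X_mem hc hd hf

theorem height_ker_param₃_le : (RingHom.ker (param₃ F)).height ≤ 3 := by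
  have hprime := RingHom.ker_isPrime (param₃ F)
  classical
  let s : Finset (MvPolynomial (Fin 8) F) :=
    {X 0 * X 3 - X 1 * X 2, X 2 * X 6 - X 3 * X 5, X 3 * X 7 - X 4 * X 6}
  have hs {Q : Ideal (MvPolynomial (Fin 8) F)} : Ideal.span (s : Set _) ≤ Q ↔
      X 0 * X 3 - X 1 * X 2 ∈ Q ∧ X 2 * X 6 - X 3 * X 5 ∈ Q ∧ X 3 * X 7 - X 4 * X 6 ∈ Q := by
    simp [s, Ideal.span_le, Set.insert_subset_iff]
  have hmin : RingHom.ker (param₃ F) ∈ (Ideal.span (s : Set _)).minimalPrimes := by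
    obtain ⟨h₁, -, h₂, -, h₃⟩ := minorIdeal_le_iff.mp (minorIdeal_le_ker_param₃ (F := F))
    refine ⟨⟨hprime, hs.mpr ⟨h₁, h₂, h₃⟩⟩, ?_⟩
    rintro Q ⟨hQ, hsQ⟩ hle
    obtain ⟨h₁, h₂, h₃⟩ := hs.mp hsQ
    refine ker_param₃_le h₁ h₂ h₃ fun h ↦ ?_
    simpa [RingHom.mem_ker, param₃] using hle h
  refine (Ideal.height_le_card_of_mem_minimalPrimes_span_finset hmin).trans ?_
  exact_mod_cast Finset.card_le_three

theorem constantCoeff_eq_zero_of_mem {p : MvPolynomial (Fin 8) F} (hp : p ∈ minorIdeal F) :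
    constantCoeff p = 0 ∧ ∀ i, constantCoeff (pderiv i p) = 0 := by
  refine Submodule.span_induction ?_ ?_ ?_ ?_ hp
  · rintro x (rfl | rfl | rfl | rfl | rfl) <;> simp
  · simp
  · rintro x y - - ⟨hx, hx'⟩ ⟨hy, hy'⟩
    simp [hx, hx', hy, hy']
  · rintro a x - ⟨hx, hx'⟩
    simp [hx, hx']

/-- The coefficients of `ad`, `ag`, `cg`, `ch`, `dh`, as second derivatives at the origin. -/
noncomputable def leadingCoeffs (F : Type*) [Field F] :
    MvPolynomial (Fin 8) F →ₗ[F] (Fin 5 → F) :=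
  LinearMap.pi fun k ↦ (aeval (R := F) (0 : Fin 8 → F)).toLinearMap ∘ₗ
    (pderiv (![0, 0, 2, 2, 3] k)).toLinearMap ∘ₗ (pderiv (![3, 6, 6, 7, 7] k)).toLinearMap

theorem leadingCoeffs_apply (p : MvPolynomial (Fin 8) F) (k : Fin 5) :
    leadingCoeffs F p k =
      constantCoeff (pderiv (![0, 0, 2, 2, 3] k) (pderiv (![3, 6, 6, 7, 7] k) p)) := by
  simp [leadingCoeffs]

theorem constantCoeff_pderiv_pderiv_mul {p : MvPolynomial (Fin 8) F} (hp : p ∈ minorIdeal F)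
    (r : MvPolynomial (Fin 8) F) (i j : Fin 8) :
    constantCoeff (pderiv i (pderiv j (r * p))) =
      constantCoeff r * constantCoeff (pderiv i (pderiv j p)) := by
  obtain ⟨h₀, h₁⟩ := constantCoeff_eq_zero_of_mem hp
  simp [h₀, h₁]

theorem leadingCoeffs_mul {p : MvPolynomial (Fin 8) F} (hp : p ∈ minorIdeal F)
    (r : MvPolynomial (Fin 8) F) :
    leadingCoeffs F (r * p) = constantCoeff r • leadingCoeffs F p := by
  ext k
  simp only [leadingCoeffs_apply, constantCoeff_pderiv_pderiv_mul hp, Pi.smul_apply, smul_eq_mul]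

theorem map_leadingCoeffs_minorIdeal :
    ((minorIdeal F).restrictScalars F).map (leadingCoeffs F) = ⊤ := by
  rw [eq_top_iff, ← (Pi.basisFun F (Fin 5)).span_eq, Submodule.span_le]
  rintro _ ⟨k, rfl⟩
  obtain ⟨h₁, h₂, h₃, h₄, h₅⟩ := minorIdeal_le_iff.mp (le_refl (minorIdeal F))
  fin_cases k
  · refine ⟨_, h₁, ?_⟩
    ext j
    fin_cases j <;> simp [leadingCoeffs_apply, pderiv_X]
  · refine ⟨_, h₂, ?_⟩
    ext j
    fin_cases j <;> simp [leadingCoeffs_apply, pderiv_X]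
  · refine ⟨_, h₃, ?_⟩
    ext j
    fin_cases j <;> simp [leadingCoeffs_apply, pderiv_X]
  · refine ⟨_, h₄, ?_⟩
    ext j
    fin_cases j <;> simp [leadingCoeffs_apply, pderiv_X]
  · refine ⟨_, h₅, ?_⟩
    ext j
    fin_cases j <;> simp [leadingCoeffs_apply, pderiv_X]

theorem five_le_of_span_range_eq {k : ℕ} {g : Fin k → MvPolynomial (Fin 8) F}
    (hg : Ideal.span (Set.range g) = minorIdeal F) : 5 ≤ k := by
  have htop : Submodule.span F (Set.range (leadingCoeffs F ∘ g)) = ⊤ := by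
    rw [eq_top_iff, ← map_leadingCoeffs_minorIdeal, Submodule.map_le_iff_le_comap]
    intro p hp
    rw [Submodule.restrictScalars_mem, ← hg, Ideal.mem_span_range_iff_exists_fun] at hp
    obtain ⟨c, rfl⟩ := hp
    rw [Submodule.mem_comap, map_sum]
    refine Submodule.sum_mem _ fun i _ ↦ ?_
    rw [leadingCoeffs_mul (hg ▸ Ideal.subset_span ⟨i, rfl⟩)]
    exact Submodule.smul_mem _ _ (Submodule.subset_span ⟨i, rfl⟩)
  have h := finrank_range_le_card (R := F) (leadingCoeffs F ∘ g)
  rw [Set.finrank, htop] at h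
  simpa using h

end CornerMatrix

open MvPolynomial in
/-- In `R = F[a,b,c,d,e,f,g,h]` (with `a,…,h` the variables `X 0,…,X 7`), the ideal
`(ad−bc, ag−bf, cg−df, ch−ef, dh−eg)` has height `3` and every generating set has at
least `5` elements. -/
theorem corner_matrix_ideal_not_lci (F : Type*) [Field F]
    (I : Ideal (MvPolynomial (Fin 8) F))
    (hI : I = Ideal.span
      {X 0 * X 3 - X 1 * X 2, X 0 * X 6 - X 1 * X 5, X 2 * X 6 - X 3 * X 5,
        X 2 * X 7 - X 4 * X 5, X 3 * X 7 - X 4 * X 6}) :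
    idealHt I = 3 ∧
      ∀ (k : ℕ) (g : Fin k → MvPolynomial (Fin 8) F),
        Ideal.span (Set.range g) = I → 5 ≤ k := by
  subst hI
  change idealHt (CornerMatrix.minorIdeal F) = 3 ∧ _
  refine ⟨le_antisymm ?_ ?_, fun k g hg ↦ CornerMatrix.five_le_of_span_range_eq hg⟩
  · have := RingHom.ker_isPrime (CornerMatrix.param₃ F)
    refine (iInf₂_le _ this).trans ((iInf_le _ CornerMatrix.minorIdeal_le_ker_param₃).trans ?_)
    rw [primeHt_eq_height]
    exact CornerMatrix.height_ker_param₃_le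
  · refine le_iInf₂ fun P hP ↦ le_iInf fun hle ↦ ?_
    rw [primeHt_eq_height]
    exact CornerMatrix.three_le_height hle
end
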